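/- Let α ∈ {14, 16, 18, 20, 22, 24}, β = 6, a, b > 0, and f(r) = a r^{-α} - b r^{-β}. If 0 < V ≤ (aα/(bβ))^{2/(α-β)}, then for every two-dimensional lattice L of co-volume V, E_f[L] ≥ E_f[√V·A₂], with equality if and only if L = O·(√V·A₂) for some orthogonal transformation O of ℝ²; that is, the triangular lattice √V·A₂ is the unique minimizer of E_f among lattices of co-volume V, up to rotation. -/

import Mathlib

open scoped Pointwise

noncomputable section

/-- A point of the Euclidean plane with coordinates `a`, `b`. -/
def vec2 (a b : ℝ) : EuclideanSpace ℝ (Fin 2) := (WithLp.equiv 2 (Fin 2 → ℝ)).symm ![a, b]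

/-- The lattice (as a set of points) generated by `u` and `v`. -/
def latticeSet (u v : EuclideanSpace ℝ (Fin 2)) : Set (EuclideanSpace ℝ (Fin 2)) :=
  {p | ∃ m n : ℤ, p = (m : ℝ) • u + (n : ℝ) • v}

/-- The determinant of the pair of plane vectors `(u, v)`. -/
def det2 (u v : EuclideanSpace ℝ (Fin 2)) : ℝ := u 0 * v 1 - u 1 * v 0

/-- `L` is a two-dimensional lattice, i.e. `L = ℤu ⊕ ℤv` for a basis `(u,v)` of ℝ². -/
def IsLattice2 (L : Set (EuclideanSpace ℝ (Fin 2))) : Prop :=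
  ∃ u v : EuclideanSpace ℝ (Fin 2), det2 u v ≠ 0 ∧ L = latticeSet u v

/-- `L` is a two-dimensional lattice of co-volume `V = |det(u,v)|`. -/
def IsLattice2OfCovol (L : Set (EuclideanSpace ℝ (Fin 2))) (V : ℝ) : Prop :=
  ∃ u v : EuclideanSpace ℝ (Fin 2), det2 u v ≠ 0 ∧ |det2 u v| = V ∧ L = latticeSet u v

/-- The Epstein zeta function of a set of points: `ζ_L(s) = Σ'_{p ∈ L, p ≠ 0} |p|^{-s}`. -/
def epsteinZeta (L : Set (EuclideanSpace ℝ (Fin 2))) (s : ℝ) : ℝ :=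
  ∑' p : ↥(L \ {0}), ‖(p : EuclideanSpace ℝ (Fin 2))‖ ^ (-s)

/-- The Lennard-Jones type energy `E_f[L] = Σ'_{p ∈ L, p ≠ 0} (a|p|^{-α} - b|p|^{-β})`. -/
def LJenergy (a b α β : ℝ) (L : Set (EuclideanSpace ℝ (Fin 2))) : ℝ :=
  ∑' p : ↥(L \ {0}),
    (a * ‖(p : EuclideanSpace ℝ (Fin 2))‖ ^ (-α) - b * ‖(p : EuclideanSpace ℝ (Fin 2))‖ ^ (-β))

/-- The triangular lattice `A₂ = √(2/√3)·[ℤ(1,0) ⊕ ℤ(1/2,√3/2)]`, of co-volume 1. -/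
def triangularLattice : Set (EuclideanSpace ℝ (Fin 2)) :=
  latticeSet (Real.sqrt (2 / Real.sqrt 3) • vec2 1 0)
    (Real.sqrt (2 / Real.sqrt 3) • vec2 (1 / 2) (Real.sqrt 3 / 2))

/-- The square lattice `ℤ² = ℤ(1,0) ⊕ ℤ(0,1)`. -/
def squareLattice : Set (EuclideanSpace ℝ (Fin 2)) := latticeSet (vec2 1 0) (vec2 0 1)

/-- `L` is the image of `L'` under an orthogonal transformation of ℝ². -/
def IsRotationOf (L L' : Set (EuclideanSpace ℝ (Fin 2))) : Prop :=
  ∃ O : EuclideanSpace ℝ (Fin 2) ≃ₗᵢ[ℝ] EuclideanSpace ℝ (Fin 2), L = O '' L'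

/-- The unit co-volume lattice parametrized by `(x, y)` in the half-fundamental domain:
`ℤu ⊕ ℤv` with `u = (1/√y, 0)` and `v = (x/√y, √y)`. -/
def latticeXY (x y : ℝ) : Set (EuclideanSpace ℝ (Fin 2)) :=
  latticeSet (vec2 (1 / Real.sqrt y) 0) (vec2 (x / Real.sqrt y) (Real.sqrt y))

/-- The Riemann zeta function `ζ(s) = Σ_{m ≥ 1} m^{-s}` (real variable version). -/
def riemannZetaReal (s : ℝ) : ℝ := ∑' n : ℕ+, (n : ℝ) ^ (-s)

end

/-- A triple of positive reals which are the values taken by a binary quadratic form, relative to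
the hexagonal form, along an orbit of the rotation of order three. -/
structure IsOrbitTriple (c x y z : ℝ) : Prop where
  pos₁ : 0 < x
  pos₂ : 0 < y
  pos₃ : 0 < z
  sum_eq : x + y + z = 3 * c
  sum_sq_eq : 2 * (x ^ 2 + y ^ 2 + z ^ 2) = 9 * c ^ 2 - 3

namespace IsOrbitTriple

variable {c x y z : ℝ}

lemma rotate (h : IsOrbitTriple c x y z) : IsOrbitTriple c y z x :=
  ⟨h.pos₂, h.pos₃, h.pos₁, by linarith [h.sum_eq], by linarith [h.sum_sq_eq]⟩

lemma one_le (h : IsOrbitTriple c x y z) : 1 ≤ c := by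
  have h1 := h.sum_eq
  have h2 := h.sum_sq_eq
  have h0 : 0 < c := by linarith [h.pos₁, h.pos₂, h.pos₃]
  have h3 : x = 3 * c - y - z := by linarith
  subst h3
  nlinarith [sq_nonneg (y - z), sq_nonneg (3 * c - y - z - y), sq_nonneg (3 * c - y - z - z)]

lemma sq_add_one_le (h : IsOrbitTriple c x y z) : x ^ 2 + 1 ≤ 2 * c * x := by
  have h1 := h.sum_eq
  have h2 := h.sum_sq_eq
  have h3 : y = 3 * c - x - z := by linarith
  subst h3
  nlinarith [sq_nonneg (3 * c - x - z - z)]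

lemma inv_add_le (h : IsOrbitTriple c x y z) : x⁻¹ ^ 2 + 1 ≤ 2 * c * x⁻¹ := by
  have h1 := h.sq_add_one_le
  have h0 := h.pos₁
  have : x⁻¹ ^ 2 * (x ^ 2 + 1) ≤ x⁻¹ ^ 2 * (2 * c * x) := by gcongr
  have e1 : x⁻¹ ^ 2 * (x ^ 2 + 1) = x⁻¹ ^ 2 + 1 := by field_simp; ring
  have e2 : x⁻¹ ^ 2 * (2 * c * x) = 2 * c * x⁻¹ := by field_simp
  rw [e1, e2] at this
  exact this

/-- A quadratic lower bound for a function sums over an orbit triple. -/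
lemma sum_quadratic_le (h : IsOrbitTriple c x y z) {f : ℝ → ℝ} {a b k : ℝ}
    (hx : a + b * x - k * x ^ 2 ≤ f x) (hy : a + b * y - k * y ^ 2 ≤ f y)
    (hz : a + b * z - k * z ^ 2 ≤ f z) :
    3 * a + 3 * b * c - k * (9 * c ^ 2 - 3) / 2 ≤ f x + f y + f z := by
  have h1 : b * (x + y + z) = b * (3 * c) := by rw [h.sum_eq]
  have h2 : k * (2 * (x ^ 2 + y ^ 2 + z ^ 2)) = k * (9 * c ^ 2 - 3) := by rw [h.sum_sq_eq]
  linarith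

lemma inv_cube_le (h : IsOrbitTriple c x y z) :
    x⁻¹ ^ 3 ≤ (4 * c ^ 2 - 1) * (2 * c - x) - 2 * c := by
  have h1 := h.inv_add_le
  have hc := h.one_le
  have h0 : 0 < x⁻¹ := inv_pos.2 h.pos₁
  have h2 : x⁻¹ ≤ 2 * c - x := by
    have := h.sq_add_one_le
    have h0 := h.pos₁
    rw [inv_le_iff_one_le_mul₀ h0]
    nlinarith
  have h3 : x⁻¹ ^ 3 ≤ (4 * c ^ 2 - 1) * x⁻¹ - 2 * c := by nlinarith
  have h4 : (4 * c ^ 2 - 1) * x⁻¹ ≤ (4 * c ^ 2 - 1) * (2 * c - x) := by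
    apply mul_le_mul_of_nonneg_left h2; nlinarith
  linarith

lemma sum_inv_cube_le_of_large (h : IsOrbitTriple c x y z) :
    x⁻¹ ^ 3 + y⁻¹ ^ 3 + z⁻¹ ^ 3 ≤ 12 * c ^ 3 - 9 * c := by
  have h1 := h.inv_cube_le
  have h2 := h.rotate.inv_cube_le
  have h3 := h.rotate.rotate.inv_cube_le
  have h4 : (4 * c ^ 2 - 1) * (x + y + z) = (4 * c ^ 2 - 1) * (3 * c) := by rw [h.sum_eq]
  linarith

end IsOrbitTriple

/-- The quotient of the second order Taylor remainder of `u ↦ u⁻¹ ^ s` at `τ⁻¹` by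
`(u - τ⁻¹) ^ 2`, as a function of `t = u⁻¹`. -/
def taylorQuot (τ t : ℝ) : ℕ → ℝ
  | 0 => 0
  | s + 1 => t * (taylorQuot τ t s + (s + 1) * τ ^ (s + 2))

lemma pow_eq_taylor {τ t : ℝ} (hτ : τ ≠ 0) (ht : t ≠ 0) (s : ℕ) :
    t ^ s = τ ^ s - s * τ ^ (s + 1) * (t⁻¹ - τ⁻¹) + (t⁻¹ - τ⁻¹) ^ 2 * taylorQuot τ t s := by
  induction s with
  | zero => simp [taylorQuot]
  | succ s ih =>
    rw [pow_succ, ih, taylorQuot]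
    push_cast
    field_simp
    ring

lemma inv_pow_sub_inv_cube_ge {r τ k u : ℝ} (s : ℕ) (hτ : 0 < τ) (hu : 0 < u)
    (hk : 0 ≤ r * taylorQuot τ u⁻¹ s - taylorQuot τ u⁻¹ 3 + k) :
    (r * τ ^ s * (1 + s) - τ ^ 3 * 4 - k * τ⁻¹ ^ 2) +
      (3 * τ ^ 4 - r * s * τ ^ (s + 1) + 2 * k * τ⁻¹) * u - k * u ^ 2 ≤
      r * u⁻¹ ^ s - u⁻¹ ^ 3 := by
  have h1 := pow_eq_taylor hτ.ne' (inv_pos.2 hu).ne' s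
  have h2 := pow_eq_taylor hτ.ne' (inv_pos.2 hu).ne' 3
  rw [h1, h2, inv_inv]
  have h3 : 0 ≤ (u - τ⁻¹) ^ 2 * (r * taylorQuot τ u⁻¹ s - taylorQuot τ u⁻¹ 3 + k) := by positivity
  have e1 : τ ^ (s + 1) * τ⁻¹ = τ ^ s := by field_simp; ring
  have e2 : τ ^ (3 + 1) * τ⁻¹ = τ ^ 3 := by field_simp
  push_cast
  have e3 : r * s * (τ ^ (s + 1) * τ⁻¹) = r * s * τ ^ s := by rw [e1]
  nlinarith [h3, e1, e2, e3]

namespace IsOrbitTriple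

variable {c x y z : ℝ}

lemma sum_inv_pow_sub_ge (h : IsOrbitTriple c x y z) {r τ k : ℝ} (s : ℕ) (hτ : 0 < τ)
    (hk : ∀ t, 0 < t → t ^ 2 + 1 ≤ 2 * c * t →
      0 ≤ r * taylorQuot τ t s - taylorQuot τ t 3 + k) :
    3 * (r * τ ^ s * (1 + s) - τ ^ 3 * 4 - k * τ⁻¹ ^ 2) +
      3 * (3 * τ ^ 4 - r * s * τ ^ (s + 1) + 2 * k * τ⁻¹) * c - k * (9 * c ^ 2 - 3) / 2 ≤
      r * (x⁻¹ ^ s + y⁻¹ ^ s + z⁻¹ ^ s) - (x⁻¹ ^ 3 + y⁻¹ ^ 3 + z⁻¹ ^ 3) := by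
  have key : ∀ {x y z : ℝ}, IsOrbitTriple c x y z → _ := fun {x y z} h =>
    inv_pow_sub_inv_cube_ge s hτ h.pos₁ (hk x⁻¹ (inv_pos.2 h.pos₁) h.inv_add_le)
  have := h.sum_quadratic_le (f := fun u => r * u⁻¹ ^ s - u⁻¹ ^ 3)
    (key h) (key h.rotate) (key h.rotate.rotate)
  linarith

lemma sum_inv_cube_le (h : IsOrbitTriple c x y z) (hc : c ≤ 117 / 100) :
    x⁻¹ ^ 3 + y⁻¹ ^ 3 + z⁻¹ ^ 3 ≤ 3 + 12 * (c - 1) + 44 * (c - 1) ^ 2 := by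
  obtain ⟨X, hX1, hX⟩ : ∃ X : ℝ, 1 ≤ X ∧ X ^ 2 + 1 = 2 * c * X := by
    have h1 := h.one_le
    have hs : Real.sqrt (c ^ 2 - 1) ^ 2 = c ^ 2 - 1 := Real.sq_sqrt (by nlinarith)
    exact ⟨c + Real.sqrt (c ^ 2 - 1), by linarith [Real.sqrt_nonneg (c ^ 2 - 1)],
      by nlinarith⟩
  have hX2 : X ≤ 178 / 100 := by nlinarith
  have hX0 : 0 < X := by linarith
  set τ : ℝ := 4 * X / (3 * X ^ 2 + 1) with hτdef
  have hτ : 0 < τ := by positivity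
  have key := h.sum_inv_pow_sub_ge (r := 0) (k := taylorQuot τ X 3) 0 hτ (by
    intro t ht htc
    have htX : t ≤ X := by
      by_contra! hlt
      nlinarith [mul_pos (sub_pos.2 hlt) ht]
    have : taylorQuot τ t 3 ≤ taylorQuot τ X 3 := by
      simp only [taylorQuot]
      push_cast
      gcongr
    linarith)
  have hcX : c = (X ^ 2 + 1) / (2 * X) := by field_simp; linarith
  have hsum : x⁻¹ ^ 3 + y⁻¹ ^ 3 + z⁻¹ ^ 3 ≤ X ^ 3 + 2 * τ ^ 3 := by
    refine le_trans (le_of_eq_of_le (by ring) (neg_le_neg key)) (le_of_eq ?_)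
    simp only [taylorQuot]
    rw [hcX, hτdef]
    push_cast
    field_simp
    ring
  refine hsum.trans ?_
  obtain ⟨w, rfl⟩ : ∃ w, X = 1 + w := ⟨X - 1, by ring⟩
  have hw0 : 0 ≤ w := by linarith
  have hw1 : w ≤ 78 / 100 := by linarith
  have hpoly : 0 ≤ 96 + 48 * w - 472 * w ^ 2 - 660 * w ^ 3 + 360 * w ^ 4 + 1449 * w ^ 5 +
      1269 * w ^ 6 + 432 * w ^ 7 - 27 * w ^ 9 := by
    have h9 : w ^ 9 ≤ w ^ 7 := pow_le_pow_of_le_one hw0 (by linarith) (by norm_num)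
    have H : ∀ i : ℕ, 0 ≤ w ^ i * (w - 51 / 100) ^ 2 := fun i => by positivity
    nlinarith [H 0, H 1, H 2, H 3, H 4, H 5, h9, pow_nonneg hw0 7, pow_nonneg hw0 6,
      pow_nonneg hw0 5]
  rw [← sub_nonneg, hcX, hτdef]
  have : 3 + 12 * (((1 + w) ^ 2 + 1) / (2 * (1 + w)) - 1) +
      44 * (((1 + w) ^ 2 + 1) / (2 * (1 + w)) - 1) ^ 2 -
      ((1 + w) ^ 3 + 2 * (4 * (1 + w) / (3 * (1 + w) ^ 2 + 1)) ^ 3) =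
      w ^ 2 * (96 + 48 * w - 472 * w ^ 2 - 660 * w ^ 3 + 360 * w ^ 4 + 1449 * w ^ 5 +
      1269 * w ^ 6 + 432 * w ^ 7 - 27 * w ^ 9) / ((1 + w) ^ 2 * (3 * (1 + w) ^ 2 + 1) ^ 3) := by
    field_simp
    ring
  rw [this]
  positivity

lemma gap_of_taylor (h : IsOrbitTriple c x y z) {r τ k B : ℝ} (s : ℕ) (hτ : 0 < τ)
    (hk : ∀ t, 0 < t → t ^ 2 + 1 ≤ 2 * c * t →
      0 ≤ r * taylorQuot τ t s - taylorQuot τ t 3 + k)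
    (hB : B + 3 * r - 3 < 3 * (r * τ ^ s * (1 + s) - τ ^ 3 * 4 - k * τ⁻¹ ^ 2) +
      3 * (3 * τ ^ 4 - r * s * τ ^ (s + 1) + 2 * k * τ⁻¹) * c - k * (9 * c ^ 2 - 3) / 2) :
    B < r * (x⁻¹ ^ s + y⁻¹ ^ s + z⁻¹ ^ s - 3) - (x⁻¹ ^ 3 + y⁻¹ ^ 3 + z⁻¹ ^ 3 - 3) := by
  linarith [h.sum_inv_pow_sub_ge s hτ hk]

lemma gap_pow_7 (h : IsOrbitTriple c x y z) (hc1 : 1 < c) (hc : c ≤ 117 / 100) :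
    66 / 1000 * (12 * (c - 1) + 44 * (c - 1) ^ 2) <
      241 / 1000 * (x⁻¹ ^ 7 + y⁻¹ ^ 7 + z⁻¹ ^ 7 - 3) -
        (x⁻¹ ^ 3 + y⁻¹ ^ 3 + z⁻¹ ^ 3 - 3) := by
  rcases le_total c (287 / 250) with hb0 | hb0
  · refine h.gap_of_taylor (τ := 1) (k := 37 / 50) 7 (by norm_num) ?_ ?_
    · intro t ht htc
      have H : ∀ i : ℕ, 0 ≤ t ^ i * (t - 6153 / 10000) ^ 2 := fun i => by positivity
      norm_num [taylorQuot]
      linarith [H 0, H 1, H 2, H 3, H 4, H 5, ht.le]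
    · norm_num
      nlinarith [mul_nonneg (sub_nonneg.2 hc1.le) (sub_nonneg.2 hb0)]
  refine h.gap_of_taylor (τ := 107 / 100) (k := 71 / 200) 7 (by norm_num) ?_ ?_
  · intro t ht htc
    have H : ∀ i : ℕ, 0 ≤ t ^ i * (t - 4471 / 10000) ^ 2 := fun i => by positivity
    norm_num [taylorQuot]
    linarith [H 0, H 1, H 2, H 3, H 4, H 5, ht.le]
  · norm_num
    nlinarith [mul_nonneg (sub_nonneg.2 hb0) (sub_nonneg.2 hc)]

lemma gap_pow_8 (h : IsOrbitTriple c x y z) (hc1 : 1 < c) (hc : c ≤ 117 / 100) :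
    66 / 1000 * (12 * (c - 1) + 44 * (c - 1) ^ 2) <
      913 / 5000 * (x⁻¹ ^ 8 + y⁻¹ ^ 8 + z⁻¹ ^ 8 - 3) -
        (x⁻¹ ^ 3 + y⁻¹ ^ 3 + z⁻¹ ^ 3 - 3) := by
  rcases le_total c (9 / 8) with hb0 | hb0
  · refine h.gap_of_taylor (τ := 1) (k := 97 / 100) 8 (by norm_num) ?_ ?_
    · intro t ht htc
      have H : ∀ i : ℕ, 0 ≤ t ^ i * (t - 6543 / 10000) ^ 2 := fun i => by positivity
      norm_num [taylorQuot]
      linarith [H 0, H 1, H 2, H 3, H 4, H 5, H 6, ht.le]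
    · norm_num
      nlinarith [mul_nonneg (sub_nonneg.2 hc1.le) (sub_nonneg.2 hb0)]
  refine h.gap_of_taylor (τ := 27 / 25) (k := 81 / 200) 8 (by norm_num) ?_ ?_
  · intro t ht htc
    have H : ∀ i : ℕ, 0 ≤ t ^ i * (t - 901 / 2000) ^ 2 := fun i => by positivity
    norm_num [taylorQuot]
    linarith [H 0, H 1, H 2, H 3, H 4, H 5, H 6, ht.le]
  · norm_num
    nlinarith [mul_nonneg (sub_nonneg.2 hb0) (sub_nonneg.2 hc)]

lemma gap_pow_9 (h : IsOrbitTriple c x y z) (hc1 : 1 < c) (hc : c ≤ 117 / 100) :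
    66 / 1000 * (12 * (c - 1) + 44 * (c - 1) ^ 2) <
      703 / 5000 * (x⁻¹ ^ 9 + y⁻¹ ^ 9 + z⁻¹ ^ 9 - 3) -
        (x⁻¹ ^ 3 + y⁻¹ ^ 3 + z⁻¹ ^ 3 - 3) := by
  rcases le_total c (1093 / 1000) with hb0 | hb0
  · refine h.gap_of_taylor (τ := 1) (k := 121 / 100) 9 (by norm_num) ?_ ?_
    · intro t ht htc
      have H : ∀ i : ℕ, 0 ≤ t ^ i * (t - 6889 / 10000) ^ 2 := fun i => by positivity
      norm_num [taylorQuot]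
      linarith [H 0, H 1, H 2, H 3, H 4, H 5, H 6, H 7, ht.le]
    · norm_num
      nlinarith [mul_nonneg (sub_nonneg.2 hc1.le) (sub_nonneg.2 hb0)]
  refine h.gap_of_taylor (τ := 27 / 25) (k := 13 / 25) 9 (by norm_num) ?_ ?_
  · intro t ht htc
    have H : ∀ i : ℕ, 0 ≤ t ^ i * (t - 2413 / 5000) ^ 2 := fun i => by positivity
    norm_num [taylorQuot]
    linarith [H 0, H 1, H 2, H 3, H 4, H 5, H 6, H 7, ht.le]
  · norm_num
    nlinarith [mul_nonneg (sub_nonneg.2 hb0) (sub_nonneg.2 hc)]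

lemma gap_pow_10 (h : IsOrbitTriple c x y z) (hc1 : 1 < c) (hc : c ≤ 117 / 100) :
    66 / 1000 * (12 * (c - 1) + 44 * (c - 1) ^ 2) <
      219 / 2000 * (x⁻¹ ^ 10 + y⁻¹ ^ 10 + z⁻¹ ^ 10 - 3) -
        (x⁻¹ ^ 3 + y⁻¹ ^ 3 + z⁻¹ ^ 3 - 3) := by
  rcases le_total c (529 / 500) with hb0 | hb0
  · refine h.gap_of_taylor (τ := 1) (k := 291 / 200) 10 (by norm_num) ?_ ?_
    · intro t ht htc
      have H : ∀ i : ℕ, 0 ≤ t ^ i * (t - 1801 / 2500) ^ 2 := fun i => by positivity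
      norm_num [taylorQuot]
      linarith [H 0, H 1, H 2, H 3, H 4, H 5, H 6, H 7, H 8, ht.le]
    · norm_num
      nlinarith [mul_nonneg (sub_nonneg.2 hc1.le) (sub_nonneg.2 hb0)]
  refine h.gap_of_taylor (τ := 27 / 25) (k := 13 / 20) 10 (by norm_num) ?_ ?_
  · intro t ht htc
    have H : ∀ i : ℕ, 0 ≤ t ^ i * (t - 641 / 1250) ^ 2 := fun i => by positivity
    norm_num [taylorQuot]
    linarith [H 0, H 1, H 2, H 3, H 4, H 5, H 6, H 7, H 8, ht.le]
  · norm_num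
    nlinarith [mul_nonneg (sub_nonneg.2 hb0) (sub_nonneg.2 hc)]

lemma gap_pow_11 (h : IsOrbitTriple c x y z) (hc1 : 1 < c) (hc : c ≤ 117 / 100) :
    66 / 1000 * (12 * (c - 1) + 44 * (c - 1) ^ 2) <
      431 / 5000 * (x⁻¹ ^ 11 + y⁻¹ ^ 11 + z⁻¹ ^ 11 - 3) -
        (x⁻¹ ^ 3 + y⁻¹ ^ 3 + z⁻¹ ^ 3 - 3) := by
  rcases le_total c (128 / 125) with hb0 | hb0
  · refine h.gap_of_taylor (τ := 1) (k := 17 / 10) 11 (by norm_num) ?_ ?_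
    · intro t ht htc
      have H : ∀ i : ℕ, 0 ≤ t ^ i * (t - 1497 / 2000) ^ 2 := fun i => by positivity
      norm_num [taylorQuot]
      linarith [H 0, H 1, H 2, H 3, H 4, H 5, H 6, H 7, H 8, H 9, ht.le]
    · norm_num
      nlinarith [mul_nonneg (sub_nonneg.2 hc1.le) (sub_nonneg.2 hb0)]
  rcases le_total c (1121 / 1000) with hb1 | hb1
  · refine h.gap_of_taylor (τ := 21 / 20) (k := 59 / 50) 11 (by norm_num) ?_ ?_
    · intro t ht htc
      have H : ∀ i : ℕ, 0 ≤ t ^ i * (t - 6359 / 10000) ^ 2 := fun i => by positivity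
      norm_num [taylorQuot]
      linarith [H 0, H 1, H 2, H 3, H 4, H 5, H 6, H 7, H 8, H 9, ht.le]
    · norm_num
      nlinarith [mul_nonneg (sub_nonneg.2 hb0) (sub_nonneg.2 hb1)]
  refine h.gap_of_taylor (τ := 109 / 100) (k := 129 / 200) 11 (by norm_num) ?_ ?_
  · intro t ht htc
    have H : ∀ i : ℕ, 0 ≤ t ^ i * (t - 5013 / 10000) ^ 2 := fun i => by positivity
    norm_num [taylorQuot]
    linarith [H 0, H 1, H 2, H 3, H 4, H 5, H 6, H 7, H 8, H 9, ht.le]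
  · norm_num
    nlinarith [mul_nonneg (sub_nonneg.2 hb1) (sub_nonneg.2 hc)]

lemma gap_pow_12 (h : IsOrbitTriple c x y z) (hc1 : 1 < c) (hc : c ≤ 117 / 100) :
    66 / 1000 * (12 * (c - 1) + 44 * (c - 1) ^ 2) <
      137 / 2000 * (x⁻¹ ^ 12 + y⁻¹ ^ 12 + z⁻¹ ^ 12 - 3) -
        (x⁻¹ ^ 3 + y⁻¹ ^ 3 + z⁻¹ ^ 3 - 3) := by
  rcases le_total c (253 / 250) with hb0 | hb0
  · refine h.gap_of_taylor (τ := 1) (k := 73 / 40) 12 (by norm_num) ?_ ?_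
    · intro t ht htc
      have htm : 171 / 200 ≤ t := by nlinarith
      have H : ∀ i : ℕ, 0 ≤ t ^ i * (t - 8549 / 10000) ^ 2 := fun i => by positivity
      have H' : ∀ i : ℕ, 0 ≤ t ^ i * (t - 8549 / 10000) ^ 2 * (t - 171 / 200) := fun i =>
        mul_nonneg (H i) (sub_nonneg.2 htm)
      norm_num [taylorQuot]
      linarith [H 0, H 1, H 2, H 3, H 4, H 5, H 6, H 7, H 8, H 9, H 10,
        H' 0, H' 1, H' 2, H' 3, H' 4, H' 5, H' 6, H' 7, H' 8, H' 9, ht.le]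
    · norm_num
      nlinarith [mul_nonneg (sub_nonneg.2 hc1.le) (sub_nonneg.2 hb0)]
  rcases le_total c (517 / 500) with hb1 | hb1
  · refine h.gap_of_taylor (τ := 103 / 100) (k := 317 / 200) 12 (by norm_num) ?_ ?_
    · intro t ht htc
      have htm : 77 / 100 ≤ t := by nlinarith
      have H : ∀ i : ℕ, 0 ≤ t ^ i * (t - 7699 / 10000) ^ 2 := fun i => by positivity
      have H' : ∀ i : ℕ, 0 ≤ t ^ i * (t - 7699 / 10000) ^ 2 * (t - 77 / 100) := fun i =>
        mul_nonneg (H i) (sub_nonneg.2 htm)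
      norm_num [taylorQuot]
      linarith [H 0, H 1, H 2, H 3, H 4, H 5, H 6, H 7, H 8, H 9, H 10,
        H' 0, H' 1, H' 2, H' 3, H' 4, H' 5, H' 6, H' 7, H' 8, H' 9, ht.le]
    · norm_num
      nlinarith [mul_nonneg (sub_nonneg.2 hb0) (sub_nonneg.2 hb1)]
  rcases le_total c (1111 / 1000) with hb2 | hb2
  · refine h.gap_of_taylor (τ := 53 / 50) (k := 49 / 40) 12 (by norm_num) ?_ ?_
    · intro t ht htc
      have H : ∀ i : ℕ, 0 ≤ t ^ i * (t - 6331 / 10000) ^ 2 := fun i => by positivity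
      norm_num [taylorQuot]
      linarith [H 0, H 1, H 2, H 3, H 4, H 5, H 6, H 7, H 8, H 9, H 10, ht.le]
    · norm_num
      nlinarith [mul_nonneg (sub_nonneg.2 hb1) (sub_nonneg.2 hb2)]
  refine h.gap_of_taylor (τ := 109 / 100) (k := 19 / 25) 12 (by norm_num) ?_ ?_
  · intro t ht htc
    have H : ∀ i : ℕ, 0 ≤ t ^ i * (t - 5257 / 10000) ^ 2 := fun i => by positivity
    norm_num [taylorQuot]
    linarith [H 0, H 1, H 2, H 3, H 4, H 5, H 6, H 7, H 8, H 9, H 10, ht.le]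
  · norm_num
    nlinarith [mul_nonneg (sub_nonneg.2 hb2) (sub_nonneg.2 hc)]

end IsOrbitTriple

lemma succ_mul_pow_le {t : ℝ} (ht : 0 ≤ t) (s : ℕ) : (s + 1) * t ^ s ≤ s * t ^ (s + 1) + 1 := by
  induction s with
  | zero => simp
  | succ s ih =>
    have h1 : 0 ≤ (t - 1) * (t ^ (s + 1) - 1) := by
      rcases le_total t 1 with h | h
      · exact mul_nonneg_of_nonpos_of_nonpos (by linarith)
          (by linarith [pow_le_one₀ (n := s + 1) ht h])
      · exact mul_nonneg (by linarith) (by linarith [one_le_pow₀ (n := s + 1) h])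
    have h2 := mul_le_mul_of_nonneg_left ih ht
    push_cast
    ring_nf at *
    linarith

namespace IsOrbitTriple

variable {c x y z : ℝ}

lemma inv_pow_seven_ge (h : IsOrbitTriple c x y z) (hc : c ≤ 117 / 100) :
    15 - 21 * x + 7 * x ^ 2 ≤ x⁻¹ ^ 7 := by
  obtain ⟨t, ht⟩ : ∃ t, t = x⁻¹ := ⟨_, rfl⟩
  have h1 := h.inv_add_le
  have h0 : 0 < x⁻¹ := inv_pos.2 h.pos₁
  have hx : x = t⁻¹ := by rw [ht, inv_inv]
  rw [← ht] at h1 h0 ⊢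
  have ht2 : 14 / 25 ≤ t := by nlinarith
  have h2 : 0 ≤ t ^ 7 + 2 * t ^ 6 + 3 * t ^ 5 + 4 * t ^ 4 + 5 * t ^ 3 + 6 * t ^ 2 + 7 * t - 7 := by
    have h3 := pow_le_pow_left₀ (by norm_num) ht2 2
    have h4 := pow_le_pow_left₀ (by norm_num) ht2 3
    have h5 := pow_le_pow_left₀ (by norm_num) ht2 4
    have h6 := pow_le_pow_left₀ (by norm_num) ht2 5
    have h7 := pow_le_pow_left₀ (by norm_num) ht2 6
    have h8 := pow_le_pow_left₀ (by norm_num) ht2 7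
    norm_num at h3 h4 h5 h6 h7 h8
    linarith
  have h3 := mul_nonneg (sq_nonneg (t - 1)) h2
  rw [hx, ← sub_nonneg]
  have : t ^ 7 - (15 - 21 * t⁻¹ + 7 * t⁻¹ ^ 2) = ((t - 1) ^ 2 *
      (t ^ 7 + 2 * t ^ 6 + 3 * t ^ 5 + 4 * t ^ 4 + 5 * t ^ 3 + 6 * t ^ 2 + 7 * t - 7)) / t ^ 2 := by
    field_simp
    ring
  rw [this]
  positivity

lemma three_le_sum_inv_pow (h : IsOrbitTriple c x y z) (hc : c ≤ 117 / 100) {s : ℕ} (hs : 7 ≤ s) :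
    3 ≤ x⁻¹ ^ s + y⁻¹ ^ s + z⁻¹ ^ s := by
  induction s, hs using Nat.le_induction with
  | base =>
    have h1 := h.one_le
    have := h.sum_quadratic_le (a := 15) (b := -21) (k := -7) (f := fun u => u⁻¹ ^ 7)
      (by linarith [h.inv_pow_seven_ge hc]) (by linarith [h.rotate.inv_pow_seven_ge hc])
      (by linarith [h.rotate.rotate.inv_pow_seven_ge hc])
    nlinarith
  | succ s hs ih =>
    have hs' : (0 : ℝ) < s := by positivity
    have h1 := succ_mul_pow_le (inv_pos.2 h.pos₁).le s
    have h2 := succ_mul_pow_le (inv_pos.2 h.pos₂).le s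
    have h3 := succ_mul_pow_le (inv_pos.2 h.pos₃).le s
    have h4 : (s + 1) * 3 ≤ (s + 1) * (x⁻¹ ^ s + y⁻¹ ^ s + z⁻¹ ^ s) := by gcongr
    have : 0 ≤ (s : ℝ) * (x⁻¹ ^ (s + 1) + y⁻¹ ^ (s + 1) + z⁻¹ ^ (s + 1) - 3) := by linarith
    linarith [nonneg_of_mul_nonneg_right this hs']

/-- An orbit triple consisting of the squared side lengths of a non-obtuse triangle, in increasing
order. -/
structure IsReduced (c x y z : ℝ) : Prop extends IsOrbitTriple c x y z where
  le₁₂ : x ≤ y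
  le₂₃ : y ≤ z
  le_add : z ≤ x + y

end IsOrbitTriple

namespace IsOrbitTriple.IsReduced

variable {c x y z : ℝ}

lemma le_one (h : IsReduced c x y z) : x ≤ 1 := by
  obtain ⟨⟨h1, h2, h3, h4, h5⟩, h6, h7, h8⟩ := h
  have e : c = (x + y + z) / 3 := by linarith
  subst e
  nlinarith [mul_nonneg h1.le (sub_nonneg.2 h6), mul_nonneg (sub_nonneg.2 h7) (sub_nonneg.2 h8),
    mul_nonneg (sub_nonneg.2 h7) h1.le]

lemma mul_le (h : IsReduced c x y z) : 6 * c * x ≤ 3 + 4 * x ^ 2 := by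
  obtain ⟨⟨h1, h2, h3, h4, h5⟩, h6, h7, h8⟩ := h
  have e : c = (x + y + z) / 3 := by linarith
  subst e
  have : 0 ≤ (x + y - z) * (2 * x - (x + y - z)) := mul_nonneg (by linarith) (by linarith)
  nlinarith

lemma three_le_four_mul (h : IsReduced c x y z) : 3 ≤ 4 * x * y := by
  obtain ⟨⟨h1, h2, h3, h4, h5⟩, h6, h7, h8⟩ := h
  have e : c = (x + y + z) / 3 := by linarith
  subst e
  nlinarith [sq_nonneg (x + y - z)]

lemma inv_ge (h : IsReduced c x y z) (hc : 117 / 100 ≤ c) : 1358 / 1000 ≤ x⁻¹ := by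
  have h1 := h.le_one
  have h2 := h.mul_le
  have h3 := h.pos₁
  have h4 : x ≤ 7361 / 10000 := by nlinarith
  rw [le_inv_comm₀ (by norm_num) h3]
  exact h4.trans (by norm_num)

lemma gap_of_large (h : IsReduced c x y z) (hc : 117 / 100 ≤ c) {r : ℝ} {s : ℕ} (hs : 7 ≤ s)
    (hr0 : 0 ≤ r) (hr1 : r ≤ 241 / 1000)
    (hr : 241 / 1000 ≤ r * (1358 / 1000) ^ (s - 7)) :
    66 / 1000 * (12 * c ^ 3 - 9 * c - 3 + 3 * r) <
      r * (x⁻¹ ^ s + y⁻¹ ^ s + z⁻¹ ^ s - 3) - (x⁻¹ ^ 3 + y⁻¹ ^ 3 + z⁻¹ ^ 3 - 3) := by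
  have hξ := h.inv_ge hc
  have hx0 := h.pos₁
  have hy0 := h.pos₂
  have hz0 := h.pos₃
  have hx : x ≤ 7364 / 10000 := by
    rw [le_inv_comm₀ (by norm_num) hx0] at hξ
    exact hξ.trans (by norm_num)
  have hy : y⁻¹ ≤ 982 / 1000 := by
    rw [inv_le_comm₀ hy0 (by norm_num)]
    have := h.three_le_four_mul
    norm_num
    nlinarith
  have hz : z⁻¹ ≤ 7212 / 10000 := by
    rw [inv_le_comm₀ hz0 (by norm_num)]
    have := h.sum_eq
    have := h.le₂₃
    norm_num
    linarith
  have hy3 := pow_le_pow_left₀ (inv_pos.2 hy0).le hy 3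
  have hz3 := pow_le_pow_left₀ (inv_pos.2 hz0).le hz 3
  have hcξ : c ≤ x⁻¹ / 2 + 491 / 1000 := by
    have h1 : 6 * c * x * x⁻¹ ≤ (3 + 4 * x ^ 2) * x⁻¹ :=
      mul_le_mul_of_nonneg_right h.mul_le (by positivity)
    have e1 : 6 * c * x * x⁻¹ = 6 * c := by field_simp
    have e2 : (3 + 4 * x ^ 2) * x⁻¹ = 3 * x⁻¹ + 4 * x := by field_simp
    linarith
  have hxs : 241 / 1000 * x⁻¹ ^ 7 ≤ r * x⁻¹ ^ s := by
    have : (1358 / 1000 : ℝ) ^ (s - 7) ≤ x⁻¹ ^ (s - 7) := by gcongr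
    calc 241 / 1000 * x⁻¹ ^ 7 ≤ r * (1358 / 1000) ^ (s - 7) * x⁻¹ ^ 7 := by gcongr
      _ ≤ r * x⁻¹ ^ (s - 7) * x⁻¹ ^ 7 := by gcongr
      _ = r * x⁻¹ ^ s := by rw [mul_assoc, ← pow_add, Nat.sub_add_cancel hs]
  have hys : 0 ≤ r * y⁻¹ ^ s := by positivity
  have hzs : 0 ≤ r * z⁻¹ ^ s := by positivity
  have hcc : 12 * c ^ 3 - 9 * c ≤
      12 * (x⁻¹ / 2 + 491 / 1000) ^ 3 - 9 * (x⁻¹ / 2 + 491 / 1000) := by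
    generalize x⁻¹ / 2 + 491 / 1000 = C at hcξ
    nlinarith [mul_nonneg (sub_nonneg.2 hcξ) (sq_nonneg (c + C)),
      mul_nonneg (sub_nonneg.2 hcξ) (sq_nonneg c), mul_nonneg (sub_nonneg.2 hcξ) (sq_nonneg C),
      mul_nonneg (sub_nonneg.2 hcξ) (sub_nonneg.2 hc),
      mul_nonneg (sub_nonneg.2 hcξ) (mul_nonneg (sub_nonneg.2 hc) (sub_nonneg.2 hc))]
  obtain ⟨δ, hδ⟩ : ∃ δ, x⁻¹ = 1358 / 1000 + δ := ⟨x⁻¹ - 1358 / 1000, by ring⟩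
  have hδ0 : 0 ≤ δ := by linarith
  rw [hδ] at hcc hxs ⊢
  have hp : ∀ n : ℕ, 0 ≤ δ ^ n := fun n => by positivity
  nlinarith [hp 1, hp 2, hp 3, hp 4, hp 5, hp 6, hp 7]

lemma pow_gap_of_large (h : IsReduced c x y z) (hc : 117 / 100 ≤ c) {s : ℕ} (hs : 7 ≤ s) :
    66 / 1000 * 3 < x⁻¹ ^ s + y⁻¹ ^ s + z⁻¹ ^ s - 3 := by
  have hξ := h.inv_ge hc
  have hy := h.pos₂
  have hz := h.pos₃
  have h1 : x⁻¹ ^ 7 ≤ x⁻¹ ^ s := pow_le_pow_right₀ (by linarith) hs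
  have h2 : (8 : ℝ) ≤ x⁻¹ ^ 7 := le_trans (by norm_num) (pow_le_pow_left₀ (by norm_num) hξ 7)
  have hys : 0 ≤ y⁻¹ ^ s := by positivity
  have hzs : 0 ≤ z⁻¹ ^ s := by positivity
  linarith

end IsOrbitTriple.IsReduced

/-- The binary quadratic form taking the values `x`, `y`, `z` at `(1, 0)`, `(0, 1)`, `(1, 1)`. -/
def binForm (x y z : ℝ) (p : ℤ × ℤ) : ℝ :=
  x * (p.1 : ℝ) ^ 2 + y * (p.2 : ℝ) ^ 2 + (z - x - y) * (p.1 * p.2)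

/-- The automorphism of order three of the hexagonal form `binForm 1 1 1`. -/
def hexRot : ℤ × ℤ ≃ ℤ × ℤ where
  toFun p := (-p.2, p.1 - p.2)
  invFun p := (p.2 - p.1, -p.1)
  left_inv p := by ext <;> simp
  right_inv p := by ext <;> simp

lemma binForm_hexRot (x y z : ℝ) (p : ℤ × ℤ) : binForm x y z (hexRot p) = binForm y z x p := by
  simp only [binForm, hexRot, Equiv.coe_fn_mk]
  push_cast
  ring

/-- The zeta function of a binary quadratic form at a natural number. -/
noncomputable def formZeta (s : ℕ) (x y z : ℝ) : ℝ := ∑' p : ℤ × ℤ, (binForm x y z p)⁻¹ ^ s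

lemma formZeta_rotate (s : ℕ) (x y z : ℝ) : formZeta s y z x = formZeta s x y z := by
  rw [formZeta, formZeta, ← hexRot.tsum_eq fun p => (binForm x y z p)⁻¹ ^ s]
  simp only [binForm_hexRot]

lemma isOrbitTriple_one : IsOrbitTriple 1 1 1 1 := by
  constructor <;> norm_num

lemma one_le_hexForm {p : ℤ × ℤ} (hp : p ≠ 0) : 1 ≤ binForm 1 1 1 p := by
  have h : 0 < p.1 ^ 2 + p.2 ^ 2 - p.1 * p.2 := by
    by_contra! hle
    have h1 : p.1 = 0 := by nlinarith [sq_nonneg (p.1 - p.2), sq_nonneg p.1, sq_nonneg p.2]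
    have h2 : p.2 = 0 := by nlinarith [sq_nonneg (p.1 - p.2), sq_nonneg p.1, sq_nonneg p.2]
    exact hp (Prod.ext h1 h2)
  have h' : (1 : ℝ) ≤ ((p.1 ^ 2 + p.2 ^ 2 - p.1 * p.2 : ℤ) : ℝ) := by exact_mod_cast h
  push_cast at h'
  simp only [binForm]
  linarith

lemma hexForm_inv_nonneg (p : ℤ × ℤ) : 0 ≤ (binForm 1 1 1 p)⁻¹ := by
  rcases eq_or_ne p 0 with rfl | hp
  · simp [binForm]
  · have := one_le_hexForm hp
    positivity

lemma sq_le_hexForm {p : ℤ × ℤ} {n : ℕ} (hp : p ∈ Finset.box n) :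
    3 / 4 * (n : ℝ) ^ 2 ≤ binForm 1 1 1 p := by
  rw [Int.mem_box] at hp
  have h : (n : ℝ) ^ 2 = (p.1 : ℝ) ^ 2 ∨ (n : ℝ) ^ 2 = (p.2 : ℝ) ^ 2 := by
    rcases max_choice p.1.natAbs p.2.natAbs with h | h
    · left
      rw [← hp, h, Nat.cast_natAbs, Int.cast_abs, sq_abs]
    · right
      rw [← hp, h, Nat.cast_natAbs, Int.cast_abs, sq_abs]
  simp only [binForm]
  rcases h with h | h <;> rw [h]
  · linarith [sq_nonneg ((p.1 : ℝ) - 2 * p.2)]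
  · linarith [sq_nonneg ((p.2 : ℝ) - 2 * p.1)]

lemma sum_box_hexForm_le {n : ℕ} (hn : n ≠ 0) :
    ∑ p ∈ Finset.box n, (binForm 1 1 1 p)⁻¹ ^ 3 ≤ 512 / 27 * (n : ℝ)⁻¹ ^ 5 := by
  have hn' : (0 : ℝ) < n := by positivity
  calc ∑ p ∈ Finset.box n, (binForm 1 1 1 p)⁻¹ ^ 3
      ≤ ∑ p ∈ (Finset.box n : Finset (ℤ × ℤ)), (3 / 4 * (n : ℝ) ^ 2)⁻¹ ^ 3 := by
        refine Finset.sum_le_sum fun p hp => ?_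
        have := sq_le_hexForm hp
        have := hexForm_inv_nonneg p
        gcongr
    _ = 512 / 27 * (n : ℝ)⁻¹ ^ 5 := by
        rw [Finset.sum_const, Int.card_box hn, nsmul_eq_mul]
        push_cast
        field_simp
        norm_num

open Finset in
lemma sum_Icc_hexForm_le {n : ℕ} (hn : 4 ≤ n) :
    ∑ p ∈ Icc (-n : ℤ × ℤ) n, (binForm 1 1 1 p)⁻¹ ^ 3 + 128 / 27 * (n : ℝ)⁻¹ ^ 4 ≤
      6396 / 1000 := by
  induction n, hn using Nat.le_induction with
  | base =>
    have h : (Icc (-(4 : ℕ) : ℤ × ℤ) (4 : ℕ)) =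
        ({-4, -3, -2, -1, 0, 1, 2, 3, 4} : Finset ℤ) ×ˢ {-4, -3, -2, -1, 0, 1, 2, 3, 4} := rfl
    rw [h, sum_product]
    norm_num [binForm, sum_insert]
  | succ n hn ih =>
    have hn0 : (0 : ℝ) < n := by positivity
    have h1 := sum_box_hexForm_le n.succ_ne_zero
    rw [← box_succ_disjUnion, sum_disjUnion]
    have h2 : 512 / 27 * ((n.succ : ℕ) : ℝ)⁻¹ ^ 5 + 128 / 27 * ((n.succ : ℕ) : ℝ)⁻¹ ^ 4 ≤
        128 / 27 * (n : ℝ)⁻¹ ^ 4 := by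
      push_cast
      rw [← sub_nonneg]
      have : 128 / 27 * (n : ℝ)⁻¹ ^ 4 -
          (512 / 27 * ((n : ℝ) + 1)⁻¹ ^ 5 + 128 / 27 * ((n : ℝ) + 1)⁻¹ ^ 4) =
          128 / 27 * (10 * (n : ℝ) ^ 3 + 10 * (n : ℝ) ^ 2 + 5 * n + 1) /
            ((n : ℝ) ^ 4 * ((n : ℝ) + 1) ^ 5) := by
        field_simp
        ring
      rw [this]
      positivity
    linarith

lemma sum_hexForm_le (F : Finset (ℤ × ℤ)) :
    ∑ p ∈ F, (binForm 1 1 1 p)⁻¹ ^ 3 ≤ 6396 / 1000 := by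
  obtain ⟨n, hn4, hn⟩ : ∃ n : ℕ, 4 ≤ n ∧ F ⊆ Finset.Icc (-n : ℤ × ℤ) n := by
    refine ⟨4 + F.sup fun p => p.1.natAbs + p.2.natAbs, by omega, fun p hp => ?_⟩
    have := Finset.le_sup (f := fun p : ℤ × ℤ => p.1.natAbs + p.2.natAbs) hp
    rw [Finset.mem_Icc, Prod.le_def, Prod.le_def]
    simp only [Prod.fst_neg, Prod.snd_neg, Prod.fst_natCast, Prod.snd_natCast]
    omega
  have h1 := sum_Icc_hexForm_le hn4
  have h2 := Finset.sum_le_sum_of_subset_of_nonneg hn fun p _ _ =>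
    pow_nonneg (hexForm_inv_nonneg p) 3
  have : (0 : ℝ) ≤ 128 / 27 * (n : ℝ)⁻¹ ^ 4 := by positivity
  linarith

lemma summable_hexForm {s : ℕ} (hs : 3 ≤ s) :
    Summable fun p : ℤ × ℤ => (binForm 1 1 1 p)⁻¹ ^ s := by
  have h3 : Summable fun p : ℤ × ℤ => (binForm 1 1 1 p)⁻¹ ^ 3 :=
    summable_of_sum_le (fun p => pow_nonneg (hexForm_inv_nonneg p) 3) sum_hexForm_le
  refine h3.of_nonneg_of_le (fun p => pow_nonneg (hexForm_inv_nonneg p) s) fun p => ?_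
  refine pow_le_pow_of_le_one (hexForm_inv_nonneg p) ?_ hs
  rcases eq_or_ne p 0 with rfl | hp
  · simp [binForm]
  · exact inv_le_one_of_one_le₀ (one_le_hexForm hp)

lemma formZeta_three_hex_le : formZeta 3 1 1 1 ≤ 6396 / 1000 :=
  (summable_hexForm le_rfl).tsum_le_of_sum_le sum_hexForm_le

namespace IsOrbitTriple

variable {c x y z : ℝ}

lemma inv_two_mul_le (h : IsOrbitTriple c x y z) : (2 * c)⁻¹ ≤ x := by
  have h1 := h.sq_add_one_le
  have h2 := h.one_le
  rw [inv_le_iff_one_le_mul₀' (by positivity)]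
  nlinarith [sq_nonneg x]

lemma binForm_pos (h : IsOrbitTriple c x y z) {p : ℤ × ℤ} (hp : p ≠ 0) : 0 < binForm x y z p := by
  have h0 := h.pos₁
  have hc : c = (x + y + z) / 3 := by linarith [h.sum_eq]
  have h2 := h.sum_sq_eq
  rw [hc] at h2
  have key : 4 * x * binForm x y z p =
      (2 * x * p.1 + (z - x - y) * p.2) ^ 2 + 3 * (p.2 : ℝ) ^ 2 := by
    simp only [binForm]
    linear_combination -(p.2 : ℝ) ^ 2 * h2
  have : 0 < 4 * x * binForm x y z p := by
    rw [key]
    rcases eq_or_ne p.2 0 with h | h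
    · have h1 : p.1 ≠ 0 := fun h1 => hp (Prod.ext h1 h)
      have : (p.1 : ℝ) ≠ 0 := by exact_mod_cast h1
      have : 0 < (2 * x * p.1) ^ 2 := by positivity
      simpa [h] using this
    · have : (p.2 : ℝ) ≠ 0 := by exact_mod_cast h
      positivity
  exact pos_of_mul_pos_right this (by positivity)

/-- The values of a form along an orbit of `hexRot`, relative to the hexagonal form. -/
lemma orbit (h : IsOrbitTriple c x y z) {p : ℤ × ℤ} (hp : p ≠ 0) :
    IsOrbitTriple c (binForm x y z p / binForm 1 1 1 p) (binForm y z x p / binForm 1 1 1 p)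
      (binForm z x y p / binForm 1 1 1 p) := by
  have h0 := isOrbitTriple_one.binForm_pos hp
  refine ⟨div_pos (h.binForm_pos hp) h0, div_pos (h.rotate.binForm_pos hp) h0,
    div_pos (h.rotate.rotate.binForm_pos hp) h0, ?_, ?_⟩
  · rw [← add_div, ← add_div, div_eq_iff h0.ne']
    simp only [binForm]
    linear_combination ((p.1 : ℝ) ^ 2 + (p.2 : ℝ) ^ 2 - p.1 * p.2) * h.sum_eq
  · simp only [div_pow]
    rw [← add_div, ← add_div, mul_div_assoc', div_eq_iff (by positivity)]
    have hc : c = (x + y + z) / 3 := by linarith [h.sum_eq]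
    have h2 := h.sum_sq_eq
    rw [hc] at h2 ⊢
    simp only [binForm]
    linear_combination ((p.1 : ℝ) ^ 2 + (p.2 : ℝ) ^ 2 - p.1 * p.2) ^ 2 * h2

lemma summable (h : IsOrbitTriple c x y z) {s : ℕ} (hs : 3 ≤ s) :
    Summable fun p : ℤ × ℤ => (binForm x y z p)⁻¹ ^ s := by
  have hc := h.one_le
  refine ((summable_hexForm hs).mul_left ((2 * c) ^ s)).of_nonneg_of_le ?_ ?_ <;> intro p <;>
    rcases eq_or_ne p 0 with rfl | hp
  · simp [binForm]
  · have := h.binForm_pos hp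
    positivity
  · simp [binForm, show s ≠ 0 by omega]
  · have h0 := isOrbitTriple_one.binForm_pos hp
    have h1 := (h.orbit hp).inv_two_mul_le
    rw [← mul_pow]
    have h2 := h.binForm_pos hp
    refine pow_le_pow_left₀ (by positivity) ?_ s
    rw [le_div_iff₀ h0] at h1
    have := inv_anti₀ (by positivity) h1
    rwa [mul_inv, inv_inv] at this

/-- Comparison of the zeta functions of a form and of the hexagonal form: the six shortest vectors
are treated exactly, the other ones by a bound valid along every orbit of `hexRot`. -/
lemma formZeta_gap (h : IsOrbitTriple c x y z) {s : ℕ} (hs : 3 ≤ s) {r e K : ℝ} (hK : 0 ≤ K)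
    (horb : ∀ {u v w μ : ℝ}, IsOrbitTriple c u v w → 0 ≤ μ → μ ≤ 1 →
      -K ≤ r * μ * (u⁻¹ ^ s + v⁻¹ ^ s + w⁻¹ ^ s - 3) - e * (u⁻¹ ^ 3 + v⁻¹ ^ 3 + w⁻¹ ^ 3 - 3)) :
    2 * (r * (x⁻¹ ^ s + y⁻¹ ^ s + z⁻¹ ^ s - 3) - e * (x⁻¹ ^ 3 + y⁻¹ ^ 3 + z⁻¹ ^ 3 - 3) -
        66 / 1000 * K) ≤
      r * (formZeta s x y z - formZeta s 1 1 1) - e * (formZeta 3 x y z - formZeta 3 1 1 1) := by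
  set g : ℤ × ℤ → ℝ := fun p =>
    r * ((binForm x y z p)⁻¹ ^ s + (binForm y z x p)⁻¹ ^ s + (binForm z x y p)⁻¹ ^ s -
      3 * (binForm 1 1 1 p)⁻¹ ^ s) -
    e * ((binForm x y z p)⁻¹ ^ 3 + (binForm y z x p)⁻¹ ^ 3 + (binForm z x y p)⁻¹ ^ 3 -
      3 * (binForm 1 1 1 p)⁻¹ ^ 3) + K * (binForm 1 1 1 p)⁻¹ ^ 3 with hg
  have hsum : HasSum g (r * (formZeta s x y z + formZeta s x y z + formZeta s x y z -
      3 * formZeta s 1 1 1) - e * (formZeta 3 x y z + formZeta 3 x y z + formZeta 3 x y z -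
      3 * formZeta 3 1 1 1) + K * formZeta 3 1 1 1) := by
    have H : ∀ {k : ℕ}, 3 ≤ k → HasSum (fun p : ℤ × ℤ =>
        (binForm x y z p)⁻¹ ^ k + (binForm y z x p)⁻¹ ^ k + (binForm z x y p)⁻¹ ^ k -
        3 * (binForm 1 1 1 p)⁻¹ ^ k) (formZeta k x y z + formZeta k x y z + formZeta k x y z -
        3 * formZeta k 1 1 1) := by
      intro k hk
      have h1 : HasSum (fun p : ℤ × ℤ => (binForm x y z p)⁻¹ ^ k) (formZeta k x y z) :=
        (h.summable hk).hasSum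
      have h2 : HasSum (fun p : ℤ × ℤ => (binForm y z x p)⁻¹ ^ k) (formZeta k x y z) := by
        rw [← formZeta_rotate]
        exact (h.rotate.summable hk).hasSum
      have h3 : HasSum (fun p : ℤ × ℤ => (binForm z x y p)⁻¹ ^ k) (formZeta k x y z) := by
        rw [← formZeta_rotate, ← formZeta_rotate]
        exact (h.rotate.rotate.summable hk).hasSum
      exact ((h1.add h2).add h3).sub ((summable_hexForm hk).hasSum.mul_left 3)
    exact (((H hs).mul_left r).sub ((H le_rfl).mul_left e)).add
      ((summable_hexForm le_rfl).hasSum.mul_left K)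
  have hg0 : ∀ p, 0 ≤ g p := by
    intro p
    rcases eq_or_ne p 0 with rfl | hp
    · simp [hg, binForm, show s ≠ 0 by omega]
    · have hN := one_le_hexForm hp
      have hN0 : 0 < binForm 1 1 1 p := by linarith
      have h1 := horb (h.orbit hp) (μ := (binForm 1 1 1 p)⁻¹ ^ (s - 3)) (by positivity)
        (pow_le_one₀ (by positivity) (inv_le_one_of_one_le₀ hN))
      have h2 := mul_nonneg (pow_nonneg (inv_pos.2 hN0).le 3) (sub_nonneg.2 h1)
      refine h2.trans_eq ?_
      have e1 : (binForm 1 1 1 p)⁻¹ ^ s =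
          (binForm 1 1 1 p)⁻¹ ^ (s - 3) * (binForm 1 1 1 p)⁻¹ ^ 3 := by
        rw [← pow_add, Nat.sub_add_cancel hs]
      have e2 : ∀ (q : ℝ) (k : ℕ),
          (q / binForm 1 1 1 p)⁻¹ ^ k * (binForm 1 1 1 p)⁻¹ ^ k = q⁻¹ ^ k := by
        intro q k
        rw [← mul_pow, inv_div, mul_comm, ← mul_div_assoc, inv_mul_cancel₀ hN0.ne', one_div]
      simp only [hg]
      rw [← e2 (binForm x y z p) s, ← e2 (binForm y z x p) s, ← e2 (binForm z x y p) s,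
        ← e2 (binForm x y z p) 3, ← e2 (binForm y z x p) 3, ← e2 (binForm z x y p) 3, e1]
      ring
  have hsix := sum_le_hasSum ({(1, 0), (0, 1), (-1, -1), (-1, 0), (0, -1), (1, 1)} :
    Finset (ℤ × ℤ)) (fun p _ => hg0 p) hsum
  have hval : ∑ p ∈ ({(1, 0), (0, 1), (-1, -1), (-1, 0), (0, -1), (1, 1)} : Finset (ℤ × ℤ)), g p =
      6 * (r * (x⁻¹ ^ s + y⁻¹ ^ s + z⁻¹ ^ s - 3) - e * (x⁻¹ ^ 3 + y⁻¹ ^ 3 + z⁻¹ ^ 3 - 3) + K) := by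
    simp [hg, binForm]
    ring
  have hZ := mul_le_mul_of_nonneg_left formZeta_three_hex_le hK
  linarith

end IsOrbitTriple

namespace IsOrbitTriple.IsReduced

variable {c x y z : ℝ}

lemma formZeta_hex_le (h : IsReduced c x y z) {s : ℕ} (hs : 7 ≤ s) :
    formZeta s 1 1 1 ≤ formZeta s x y z := by
  rcases le_total c (117 / 100) with hc | hc
  · have h1 := h.three_le_sum_inv_pow hc hs
    have := h.formZeta_gap (s := s) (r := 1) (e := 0) (K := 0) (by omega) le_rfl (by
      intro u v w μ h' hμ _
      have := h'.three_le_sum_inv_pow hc hs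
      have := mul_nonneg hμ (sub_nonneg.2 this)
      linarith)
    linarith
  · have h1 := h.pow_gap_of_large hc hs
    have := h.formZeta_gap (s := s) (r := 1) (e := 0) (K := 3) (by omega) (by norm_num) (by
      intro u v w μ h' hμ hμ1
      have hu := inv_pos.2 h'.pos₁
      have hv := inv_pos.2 h'.pos₂
      have hw := inv_pos.2 h'.pos₃
      have : 0 ≤ μ * (u⁻¹ ^ s + v⁻¹ ^ s + w⁻¹ ^ s) := by positivity
      linarith)
    linarith

lemma formZeta_gap_of_pow_gap (h : IsReduced c x y z) (hc1 : 1 < c) {s : ℕ} {r : ℝ} (hs : 7 ≤ s)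
    (hr0 : 0 ≤ r) (hr1 : r ≤ 241 / 1000) (hr : 241 / 1000 ≤ r * (1358 / 1000) ^ (s - 7))
    (hgap : c ≤ 117 / 100 → 66 / 1000 * (12 * (c - 1) + 44 * (c - 1) ^ 2) <
      r * (x⁻¹ ^ s + y⁻¹ ^ s + z⁻¹ ^ s - 3) - (x⁻¹ ^ 3 + y⁻¹ ^ 3 + z⁻¹ ^ 3 - 3)) :
    formZeta 3 x y z - formZeta 3 1 1 1 < r * (formZeta s x y z - formZeta s 1 1 1) := by
  rcases le_total c (117 / 100) with hc | hc
  · have h1 := hgap hc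
    have := h.formZeta_gap (s := s) (r := r) (e := 1)
      (K := 12 * (c - 1) + 44 * (c - 1) ^ 2) (by omega) (by nlinarith) (by
      intro u v w μ h' hμ _
      have h2 := h'.sum_inv_cube_le hc
      have h3 := h'.three_le_sum_inv_pow hc hs
      have := mul_nonneg (mul_nonneg hr0 hμ) (sub_nonneg.2 h3)
      linarith)
    linarith
  · have h1 := h.gap_of_large hc hs hr0 hr1 hr
    have := h.formZeta_gap (s := s) (r := r) (e := 1)
      (K := 12 * c ^ 3 - 9 * c - 3 + 3 * r) (by omega)
      (by nlinarith [pow_le_pow_left₀ (by norm_num) hc 2]) (by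
      intro u v w μ h' hμ hμ1
      have h2 := h'.sum_inv_cube_le_of_large
      have hu := inv_pos.2 h'.pos₁
      have hv := inv_pos.2 h'.pos₂
      have hw := inv_pos.2 h'.pos₃
      have h3 : 0 ≤ r * μ * (u⁻¹ ^ s + v⁻¹ ^ s + w⁻¹ ^ s) := by positivity
      have h4 : r * μ ≤ r := mul_le_of_le_one_right hr0 hμ1
      linarith)
    linarith

end IsOrbitTriple.IsReduced

/-- The density threshold of the exponent pair `(2 * s, 6)`, relative to the squared minimal
distance of the triangular lattice, multiplied by `b / a`. -/
noncomputable def thresholdRatio (s : ℕ) : ℝ := 3 / s * (2 / √3)⁻¹ ^ (s - 3)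

lemma IsOrbitTriple.IsReduced.formZeta_gap_threshold {c x y z : ℝ} (h : IsReduced c x y z)
    (hc1 : 1 < c) {s : ℕ} (hs : s ∈ Finset.Icc 7 12) :
    formZeta 3 x y z - formZeta 3 1 1 1 <
      thresholdRatio s * (formZeta s x y z - formZeta s 1 1 1) := by
  have h3 : √3 ^ 2 = 3 := Real.sq_sqrt (by norm_num)
  have h3' : (17320508 / 10000000 : ℝ) ≤ √3 := Real.le_sqrt_of_sq_le (by norm_num)
  have hp : ∀ k, √3 ^ (2 * k) = 3 ^ k := fun k => by rw [pow_mul, h3]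
  have red : ∀ r : ℝ, r ≤ thresholdRatio s →
      formZeta 3 x y z - formZeta 3 1 1 1 < r * (formZeta s x y z - formZeta s 1 1 1) →
      formZeta 3 x y z - formZeta 3 1 1 1 <
        thresholdRatio s * (formZeta s x y z - formZeta s 1 1 1) := fun r hr hlt =>
    hlt.trans_le (mul_le_mul_of_nonneg_right hr
      (sub_nonneg.2 (h.formZeta_hex_le (Finset.mem_Icc.1 hs).1)))
  have ev : ∀ k, (2 / √3)⁻¹ ^ k = √3 ^ k / 2 ^ k := fun k => by rw [inv_div, div_pow]
  have e5 : √3 ^ 5 = 9 * √3 := by rw [pow_succ, hp 2]; norm_num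
  have e7 : √3 ^ 7 = 27 * √3 := by rw [pow_succ, hp 3]; norm_num
  have e9 : √3 ^ 9 = 81 * √3 := by rw [pow_succ, hp 4]; norm_num
  fin_cases hs
  · refine red (241 / 1000) ?_ (h.formZeta_gap_of_pow_gap hc1 le_rfl (by norm_num) (by norm_num)
      (by norm_num) (h.gap_pow_7 hc1))
    rw [thresholdRatio, ev, hp 2]
    norm_num
  · refine red (913 / 5000) ?_ (h.formZeta_gap_of_pow_gap hc1 (by norm_num) (by norm_num)
      (by norm_num) (by norm_num) (h.gap_pow_8 hc1))
    rw [thresholdRatio, ev, e5]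
    norm_num
    linarith
  · refine red (703 / 5000) ?_ (h.formZeta_gap_of_pow_gap hc1 (by norm_num) (by norm_num)
      (by norm_num) (by norm_num) (h.gap_pow_9 hc1))
    rw [thresholdRatio, ev, hp 3]
    norm_num
  · refine red (219 / 2000) ?_ (h.formZeta_gap_of_pow_gap hc1 (by norm_num) (by norm_num)
      (by norm_num) (by norm_num) (h.gap_pow_10 hc1))
    rw [thresholdRatio, ev, e7]
    norm_num
    linarith
  · refine red (431 / 5000) ?_ (h.formZeta_gap_of_pow_gap hc1 (by norm_num) (by norm_num)
      (by norm_num) (by norm_num) (h.gap_pow_11 hc1))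
    rw [thresholdRatio, ev, hp 4]
    norm_num
  · refine red (137 / 2000) ?_ (h.formZeta_gap_of_pow_gap hc1 (by norm_num) (by norm_num)
      (by norm_num) (by norm_num) (h.gap_pow_12 hc1))
    rw [thresholdRatio, ev, e9]
    norm_num
    linarith

lemma norm_sq_combo (u v : EuclideanSpace ℝ (Fin 2)) (m n : ℝ) :
    ‖m • u + n • v‖ ^ 2 =
      ‖u‖ ^ 2 * m ^ 2 + ‖v‖ ^ 2 * n ^ 2 + (‖u + v‖ ^ 2 - ‖u‖ ^ 2 - ‖v‖ ^ 2) * (m * n) := by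
  simp only [EuclideanSpace.real_norm_sq_eq, Fin.sum_univ_two, PiLp.add_apply, PiLp.smul_apply,
    smul_eq_mul]
  ring

lemma det2_sq (u v : EuclideanSpace ℝ (Fin 2)) :
    4 * det2 u v ^ 2 = 4 * ‖u‖ ^ 2 * ‖v‖ ^ 2 - (‖u + v‖ ^ 2 - ‖u‖ ^ 2 - ‖v‖ ^ 2) ^ 2 := by
  simp only [EuclideanSpace.real_norm_sq_eq, Fin.sum_univ_two, PiLp.add_apply, det2]
  ring

lemma combo_injective {u v : EuclideanSpace ℝ (Fin 2)} (h : det2 u v ≠ 0) :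
    Function.Injective fun p : ℤ × ℤ => (p.1 : ℝ) • u + (p.2 : ℝ) • v := by
  intro p q hpq
  have h0 := congrArg (fun w : EuclideanSpace ℝ (Fin 2) => w 0) hpq
  have h1 := congrArg (fun w : EuclideanSpace ℝ (Fin 2) => w 1) hpq
  simp only [PiLp.add_apply, PiLp.smul_apply, smul_eq_mul] at h0 h1
  have e1 : ((p.1 : ℝ) - q.1) * det2 u v = 0 := by
    rw [det2]
    linear_combination v 1 * h0 - v 0 * h1
  have e2 : ((p.2 : ℝ) - q.2) * det2 u v = 0 := by
    rw [det2]
    linear_combination u 0 * h1 - u 1 * h0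
  have e1' := (mul_eq_zero.1 e1).resolve_right h
  have e2' := (mul_eq_zero.1 e2).resolve_right h
  ext
  · exact_mod_cast sub_eq_zero.1 e1'
  · exact_mod_cast sub_eq_zero.1 e2'

lemma latticeSet_eq_range (u v : EuclideanSpace ℝ (Fin 2)) :
    latticeSet u v = Set.range fun p : ℤ × ℤ => (p.1 : ℝ) • u + (p.2 : ℝ) • v := by
  ext w
  constructor
  · rintro ⟨m, n, rfl⟩
    exact ⟨(m, n), rfl⟩
  · rintro ⟨p, rfl⟩
    exact ⟨p.1, p.2, rfl⟩

lemma LJenergy_latticeSet {u v : EuclideanSpace ℝ (Fin 2)} (hdet : det2 u v ≠ 0)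
    {c x y z Λ : ℝ} (h : IsOrbitTriple c x y z) (hu : ‖u‖ ^ 2 = Λ * x)
    (hv : ‖v‖ ^ 2 = Λ * y) (huv : ‖u + v‖ ^ 2 = Λ * z) (a b : ℝ) {s : ℕ} (hs : 3 ≤ s) :
    LJenergy a b (2 * s) 6 (latticeSet u v) =
      a * Λ⁻¹ ^ s * formZeta s x y z - b * Λ⁻¹ ^ 3 * formZeta 3 x y z := by
  set φ : ℤ × ℤ → EuclideanSpace ℝ (Fin 2) := fun p => (p.1 : ℝ) • u + (p.2 : ℝ) • v with hφ
  have hinj : Function.Injective φ := combo_injective hdet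
  have hφ0 : φ 0 = 0 := by simp [hφ]
  have hset : latticeSet u v \ {0} = φ '' {0}ᶜ := by
    rw [latticeSet_eq_range, Set.image_compl_eq_range_sdiff_image hinj, Set.image_singleton, hφ0]
  have hnorm : ∀ p, ‖φ p‖ ^ 2 = Λ * binForm x y z p := fun p => by
    rw [hφ, norm_sq_combo, hu, hv, huv, binForm]
    ring
  have hpow : ∀ (k : ℕ) (p : ℤ × ℤ),
      ‖φ p‖ ^ (-(2 * (k : ℝ))) = Λ⁻¹ ^ k * (binForm x y z p)⁻¹ ^ k := by
    intro k p
    rw [Real.rpow_neg (norm_nonneg _), Real.rpow_mul (norm_nonneg _), Real.rpow_natCast,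
      Real.rpow_ofNat, hnorm, ← mul_pow, ← mul_inv, inv_pow]
  have hpow3 : ∀ p : ℤ × ℤ, ‖φ p‖ ^ (-6 : ℝ) = Λ⁻¹ ^ 3 * (binForm x y z p)⁻¹ ^ 3 := by
    intro p
    rw [← hpow 3 p]
    norm_num
  rw [LJenergy, hset, tsum_image (f := fun q : EuclideanSpace ℝ (Fin 2) =>
    a * ‖q‖ ^ (-(2 * (s : ℝ))) - b * ‖q‖ ^ (-6 : ℝ)) hinj.injOn]
  simp only [hpow, hpow3]
  rw [tsum_subtype_eq_of_support_subset (f := fun p : ℤ × ℤ =>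
    a * (Λ⁻¹ ^ s * (binForm x y z p)⁻¹ ^ s) - b * (Λ⁻¹ ^ 3 * (binForm x y z p)⁻¹ ^ 3))]
  · simp only [← mul_assoc]
    rw [((h.summable hs).mul_left _).tsum_sub ((h.summable le_rfl).mul_left _), tsum_mul_left,
      tsum_mul_left, formZeta, formZeta]
  · intro p hp hp0
    refine hp ?_
    rw [Set.mem_singleton_iff.1 hp0]
    simp [binForm, show s ≠ 0 by omega]

lemma isOrbitTriple_norm_sq {u v : EuclideanSpace ℝ (Fin 2)} {V : ℝ} (hV : 0 < V)
    (hdet : |det2 u v| = V) :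
    IsOrbitTriple ((‖u‖ ^ 2 + ‖v‖ ^ 2 + ‖u + v‖ ^ 2) / (V * (2 / √3)) / 3)
      (‖u‖ ^ 2 / (V * (2 / √3))) (‖v‖ ^ 2 / (V * (2 / √3))) (‖u + v‖ ^ 2 / (V * (2 / √3))) := by
  have h3 : √3 ^ 2 = 3 := Real.sq_sqrt (by norm_num)
  have hΛ : 0 < V * (2 / √3) := by positivity
  have hd0 : det2 u v ≠ 0 := by
    intro h
    simp [h] at hdet
    linarith
  have hne : ∀ w : EuclideanSpace ℝ (Fin 2), w ≠ 0 → 0 < ‖w‖ ^ 2 := fun w hw => by positivity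
  refine ⟨div_pos (hne _ ?_) hΛ, div_pos (hne _ ?_) hΛ, div_pos (hne _ ?_) hΛ, by ring, ?_⟩
  · rintro rfl
    simp [det2] at hd0
  · rintro rfl
    simp [det2] at hd0
  · intro h
    rw [add_eq_zero_iff_eq_neg] at h
    simp [h, det2] at hd0
    exact hd0 (by ring)
  · have h1 := det2_sq u v
    rw [← sq_abs, hdet] at h1
    field_simp
    rw [h3]
    linarith

lemma latticeSet_swap (u v : EuclideanSpace ℝ (Fin 2)) : latticeSet v u = latticeSet u v := by
  ext w
  constructor <;> rintro ⟨m, n, rfl⟩ <;> exact ⟨n, m, add_comm _ _⟩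

lemma latticeSet_neg (u v : EuclideanSpace ℝ (Fin 2)) : latticeSet u (-v) = latticeSet u v := by
  ext w
  constructor <;> rintro ⟨m, n, rfl⟩ <;> exact ⟨m, -n, by simp⟩

lemma latticeSet_shear (u v : EuclideanSpace ℝ (Fin 2)) :
    latticeSet u (u + v) = latticeSet u v := by
  ext w
  constructor
  · rintro ⟨m, n, rfl⟩
    exact ⟨m + n, n, by push_cast; module⟩
  · rintro ⟨m, n, rfl⟩
    exact ⟨m - n, n, by push_cast; module⟩

lemma left_mem_latticeSet (u v : EuclideanSpace ℝ (Fin 2)) : u ∈ latticeSet u v :=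
  ⟨1, 0, by simp⟩

lemma finite_latticeSet_norm_le {u v : EuclideanSpace ℝ (Fin 2)} (hdet : det2 u v ≠ 0) (B : ℝ) :
    {w ∈ latticeSet u v | ‖w‖ ^ 2 ≤ B}.Finite := by
  have h := isOrbitTriple_norm_sq (abs_pos.2 hdet) rfl
  set Λ := |det2 u v| * (2 / √3) with hΛdef
  have hΛ : 0 < Λ := by have := abs_pos.2 hdet; positivity
  have h1 := (h.summable le_rfl).tendsto_cofinite_zero
  have hB : 0 < (Λ⁻¹ * (|B| + 1))⁻¹ ^ 3 := by positivity
  have h2 := h1.eventually_lt_const hB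
  rw [Filter.eventually_cofinite] at h2
  refine ((h2.union (Set.finite_singleton 0)).image
    fun p : ℤ × ℤ => (p.1 : ℝ) • u + (p.2 : ℝ) • v).subset ?_
  rintro w ⟨⟨m, n, rfl⟩, hw⟩
  refine ⟨(m, n), ?_, rfl⟩
  by_cases h0 : (m, n) = (0 : ℤ × ℤ)
  · exact Or.inr h0
  · left
    have hpos := h.binForm_pos h0
    have e : ‖(m : ℝ) • u + (n : ℝ) • v‖ ^ 2 = Λ * binForm (‖u‖ ^ 2 / Λ) (‖v‖ ^ 2 / Λ)
        (‖u + v‖ ^ 2 / Λ) (m, n) := by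
      rw [norm_sq_combo, binForm]
      field_simp
    rw [e] at hw
    rw [Set.mem_ofPred_eq, not_lt]
    have : binForm (‖u‖ ^ 2 / Λ) (‖v‖ ^ 2 / Λ) (‖u + v‖ ^ 2 / Λ) (m, n) ≤ Λ⁻¹ * (|B| + 1) := by
      rw [inv_mul_eq_div, le_div_iff₀ hΛ]
      linarith [le_abs_self B]
    gcongr

/-- `(u, v)` is a basis of the lattice `L` of co-volume `V`. -/
def IsLatticeBasis (L : Set (EuclideanSpace ℝ (Fin 2))) (V : ℝ)
    (u v : EuclideanSpace ℝ (Fin 2)) : Prop :=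
  |det2 u v| = V ∧ latticeSet u v = L

namespace IsLatticeBasis

variable {L : Set (EuclideanSpace ℝ (Fin 2))} {V : ℝ} {u v : EuclideanSpace ℝ (Fin 2)}

lemma swap (h : IsLatticeBasis L V u v) : IsLatticeBasis L V v u := by
  refine ⟨?_, (latticeSet_swap _ _).trans h.2⟩
  rw [← h.1, ← abs_neg]
  congr 1
  simp only [det2]
  ring

lemma neg (h : IsLatticeBasis L V u v) : IsLatticeBasis L V u (-v) := by
  refine ⟨?_, (latticeSet_neg _ _).trans h.2⟩
  rw [← h.1, ← abs_neg]
  congr 1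
  simp only [det2, PiLp.neg_apply]
  ring

lemma shear (h : IsLatticeBasis L V u v) : IsLatticeBasis L V u (u + v) := by
  refine ⟨?_, (latticeSet_shear _ _).trans h.2⟩
  rw [← h.1]
  congr 1
  simp only [det2, PiLp.add_apply]
  ring

lemma exists_minimal (h : IsLatticeBasis L V u v) (hV : 0 < V) :
    ∃ p q, IsLatticeBasis L V p q ∧ ∀ p' q', IsLatticeBasis L V p' q' →
      ‖p‖ ^ 2 + ‖q‖ ^ 2 + ‖p + q‖ ^ 2 ≤ ‖p'‖ ^ 2 + ‖q'‖ ^ 2 + ‖p' + q'‖ ^ 2 := by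
  have hd0 : det2 u v ≠ 0 := abs_pos.1 (h.1 ▸ hV)
  generalize hB : ‖u‖ ^ 2 + ‖v‖ ^ 2 + ‖u + v‖ ^ 2 = B
  have hfin : {p : EuclideanSpace ℝ (Fin 2) × EuclideanSpace ℝ (Fin 2) |
      IsLatticeBasis L V p.1 p.2 ∧
        ‖p.1‖ ^ 2 + ‖p.2‖ ^ 2 + ‖p.1 + p.2‖ ^ 2 ≤ B}.Finite := by
    refine ((finite_latticeSet_norm_le hd0 B).prod (finite_latticeSet_norm_le hd0 B)).subset ?_
    rintro ⟨p, q⟩ ⟨hp, hle⟩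
    dsimp only at hp hle
    have h1 : p ∈ latticeSet u v := by
      rw [h.2, ← hp.2]
      exact left_mem_latticeSet p q
    have h2 : q ∈ latticeSet u v := by
      rw [h.2, ← hp.swap.2]
      exact left_mem_latticeSet q p
    exact ⟨⟨h1, by linarith [sq_nonneg ‖q‖, sq_nonneg ‖p + q‖]⟩,
      ⟨h2, by linarith [sq_nonneg ‖p‖, sq_nonneg ‖p + q‖]⟩⟩
  obtain ⟨⟨p, q⟩, hp, hpm⟩ := Set.exists_min_image _
    (fun p => ‖p.1‖ ^ 2 + ‖p.2‖ ^ 2 + ‖p.1 + p.2‖ ^ 2) hfin ⟨(u, v), h, hB.le⟩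
  refine ⟨p, q, hp.1, fun p' q' hq => ?_⟩
  rcases le_total (‖p'‖ ^ 2 + ‖q'‖ ^ 2 + ‖p' + q'‖ ^ 2) B with h | h
  · exact hpm (p', q') ⟨hq, h⟩
  · exact hp.2.trans h

/-- Every lattice of the plane has a basis `(p, q)` such that the triangle with sides `p`, `q`,
`p + q` is not obtuse, with side lengths in increasing order. -/
lemma exists_reduced (h : IsLatticeBasis L V u v) (hV : 0 < V) :
    ∃ p q, IsLatticeBasis L V p q ∧ ‖p‖ ^ 2 ≤ ‖q‖ ^ 2 ∧ ‖q‖ ^ 2 ≤ ‖p + q‖ ^ 2 ∧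
      ‖p + q‖ ^ 2 ≤ ‖p‖ ^ 2 + ‖q‖ ^ 2 := by
  obtain ⟨p, q, hpT, hmin⟩ := h.exists_minimal hV
  have hz : ‖p + q‖ ^ 2 ≤ ‖p‖ ^ 2 + ‖q‖ ^ 2 := by
    have h1 : ‖p‖ ^ 2 + ‖q‖ ^ 2 + ‖p + q‖ ^ 2 ≤ ‖p‖ ^ 2 + ‖-q‖ ^ 2 + ‖p + -q‖ ^ 2 :=
      hmin _ _ hpT.neg
    have h2 := norm_sq_combo p q 1 (-1)
    rw [one_smul, neg_one_smul] at h2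
    rw [norm_neg, h2] at h1
    linarith
  have hx : ‖p‖ ^ 2 ≤ ‖q‖ ^ 2 + ‖p + q‖ ^ 2 := by
    have h1 : ‖p‖ ^ 2 + ‖q‖ ^ 2 + ‖p + q‖ ^ 2 ≤
        ‖q‖ ^ 2 + ‖q + p‖ ^ 2 + ‖q + (q + p)‖ ^ 2 := hmin _ _ hpT.swap.shear
    have h2 := norm_sq_combo p q 1 2
    rw [show (1 : ℝ) • p + (2 : ℝ) • q = q + (q + p) by module] at h2
    rw [h2, add_comm q p] at h1
    linarith
  have hy : ‖q‖ ^ 2 ≤ ‖p‖ ^ 2 + ‖p + q‖ ^ 2 := by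
    have h1 : ‖p‖ ^ 2 + ‖q‖ ^ 2 + ‖p + q‖ ^ 2 ≤
        ‖p‖ ^ 2 + ‖p + q‖ ^ 2 + ‖p + (p + q)‖ ^ 2 := hmin _ _ hpT.shear
    have h2 := norm_sq_combo p q 2 1
    rw [show (2 : ℝ) • p + (1 : ℝ) • q = p + (p + q) by module] at h2
    rw [h2] at h1
    linarith
  have e1 : ‖p + -(p + q)‖ = ‖q‖ := by rw [← norm_neg]; congr 1; abel
  have e2 : ‖q + -(q + p)‖ = ‖p‖ := by rw [← norm_neg]; congr 1; abel
  have e3 : ‖-(p + q) + p‖ = ‖q‖ := by rw [← norm_neg]; congr 1; abel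
  have e4 : ‖-(q + p) + q‖ = ‖p‖ := by rw [← norm_neg]; congr 1; abel
  have e5 : ‖q + p‖ = ‖p + q‖ := by rw [add_comm]
  rcases le_total (‖p‖ ^ 2) (‖q‖ ^ 2) with h1 | h1 <;>
    rcases le_total (‖q‖ ^ 2) (‖p + q‖ ^ 2) with h2 | h2 <;>
    rcases le_total (‖p‖ ^ 2) (‖p + q‖ ^ 2) with h3 | h3
  · exact ⟨p, q, hpT, h1, h2, hz⟩
  · exact ⟨p, q, hpT, h1, h2, hz⟩
  · refine ⟨_, _, hpT.shear.neg, ?_, ?_, ?_⟩ <;> simp only [norm_neg, e1] <;> linarith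
  · refine ⟨_, _, hpT.shear.neg.swap, ?_, ?_, ?_⟩ <;> simp only [norm_neg, e3] <;> linarith
  · exact ⟨_, _, hpT.swap, h1, by rwa [e5], by rw [e5]; linarith⟩
  · refine ⟨_, _, hpT.swap.shear.neg, ?_, ?_, ?_⟩ <;> simp only [norm_neg, e2, e5] <;> linarith
  · refine ⟨_, _, hpT.swap.shear.neg.swap, ?_, ?_, ?_⟩ <;>
      simp only [norm_neg, e4, e5] <;> linarith
  · refine ⟨_, _, hpT.swap.shear.neg.swap, ?_, ?_, ?_⟩ <;>
      simp only [norm_neg, e4, e5] <;> linarith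

end IsLatticeBasis

lemma IsLatticeBasis.isReduced {L : Set (EuclideanSpace ℝ (Fin 2))} {V : ℝ}
    {u v : EuclideanSpace ℝ (Fin 2)} (h : IsLatticeBasis L V u v) (hV : 0 < V)
    (h1 : ‖u‖ ^ 2 ≤ ‖v‖ ^ 2) (h2 : ‖v‖ ^ 2 ≤ ‖u + v‖ ^ 2)
    (h3 : ‖u + v‖ ^ 2 ≤ ‖u‖ ^ 2 + ‖v‖ ^ 2) :
    IsOrbitTriple.IsReduced ((‖u‖ ^ 2 + ‖v‖ ^ 2 + ‖u + v‖ ^ 2) / (V * (2 / √3)) / 3)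
      (‖u‖ ^ 2 / (V * (2 / √3))) (‖v‖ ^ 2 / (V * (2 / √3))) (‖u + v‖ ^ 2 / (V * (2 / √3))) :=
  ⟨isOrbitTriple_norm_sq hV h.1, by gcongr, by gcongr, by rw [← add_div]; gcongr⟩

lemma IsOrbitTriple.eq_one {x y z : ℝ} (h : IsOrbitTriple 1 x y z) : x = 1 ∧ y = 1 ∧ z = 1 := by
  have key : ∀ {x y z : ℝ}, IsOrbitTriple 1 x y z → x = 1 := fun {x y z} h => by
    nlinarith [h.sq_add_one_le, sq_nonneg (x - 1)]
  exact ⟨key h, key h.rotate, key h.rotate.rotate⟩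

lemma LJenergy_image (a b α β : ℝ)
    (O : EuclideanSpace ℝ (Fin 2) ≃ₗᵢ[ℝ] EuclideanSpace ℝ (Fin 2))
    (L : Set (EuclideanSpace ℝ (Fin 2))) : LJenergy a b α β (O '' L) = LJenergy a b α β L := by
  have hset : O '' L \ {0} = O '' (L \ {0}) := by
    rw [Set.image_sdiff O.injective, Set.image_singleton, map_zero]
  rw [LJenergy, hset, tsum_image (f := fun q : EuclideanSpace ℝ (Fin 2) =>
    a * ‖q‖ ^ (-α) - b * ‖q‖ ^ (-β)) O.injective.injOn]
  simp only [LinearIsometryEquiv.norm_map]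
  rfl

lemma image_latticeSet (O : EuclideanSpace ℝ (Fin 2) ≃ₗᵢ[ℝ] EuclideanSpace ℝ (Fin 2))
    (u v : EuclideanSpace ℝ (Fin 2)) : O '' latticeSet u v = latticeSet (O u) (O v) := by
  rw [latticeSet_eq_range, latticeSet_eq_range, ← Set.range_comp]
  congr 1
  ext1 p
  simp

lemma linearIndependent_of_det2 {u v : EuclideanSpace ℝ (Fin 2)} (h : det2 u v ≠ 0) :
    LinearIndependent ℝ ![u, v] := by
  rw [LinearIndependent.pair_iff]
  intro m n hmn
  have h0 := congrArg (fun w : EuclideanSpace ℝ (Fin 2) => w 0) hmn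
  have h1 := congrArg (fun w : EuclideanSpace ℝ (Fin 2) => w 1) hmn
  simp only [PiLp.add_apply, PiLp.smul_apply, smul_eq_mul, PiLp.zero_apply] at h0 h1
  constructor
  · refine (mul_eq_zero.1 ?_).resolve_right h
    rw [det2]
    linear_combination v 1 * h0 - v 0 * h1
  · refine (mul_eq_zero.1 ?_).resolve_right h
    rw [det2]
    linear_combination u 0 * h1 - u 1 * h0

/-- Two congruent pairs of linearly independent vectors are exchanged by an isometry. -/
lemma exists_isometry {u v u' v' : EuclideanSpace ℝ (Fin 2)} (h : det2 u v ≠ 0)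
    (hu : ‖u‖ ^ 2 = ‖u'‖ ^ 2) (hv : ‖v‖ ^ 2 = ‖v'‖ ^ 2) (huv : ‖u + v‖ ^ 2 = ‖u' + v'‖ ^ 2) :
    ∃ O : EuclideanSpace ℝ (Fin 2) ≃ₗᵢ[ℝ] EuclideanSpace ℝ (Fin 2), O u = u' ∧ O v = v' := by
  set B := basisOfLinearIndependentOfCardEqFinrank (linearIndependent_of_det2 h) (by simp) with hB
  have hB0 : B 0 = u := by simp [hB]
  have hB1 : B 1 = v := by simp [hB]
  set f : EuclideanSpace ℝ (Fin 2) →ₗ[ℝ] EuclideanSpace ℝ (Fin 2) := B.constr ℝ ![u', v'] with hf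
  have hfu : f u = u' := by rw [← hB0, hf, Module.Basis.constr_basis]; rfl
  have hfv : f v = v' := by rw [← hB1, hf, Module.Basis.constr_basis]; rfl
  have hnorm : ∀ w, ‖f w‖ = ‖w‖ := by
    intro w
    have hw := B.sum_repr w
    rw [Fin.sum_univ_two, hB0, hB1] at hw
    rw [← sq_eq_sq₀ (norm_nonneg _) (norm_nonneg _), ← hw, map_add, map_smul, map_smul, hfu, hfv,
      norm_sq_combo, norm_sq_combo, hu, hv, huv]
  exact ⟨LinearIsometry.toLinearIsometryEquiv ⟨f, hnorm⟩ rfl, hfu, hfv⟩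

/-- The scaled triangular lattice has a basis `(u, v)` such that `u`, `v`, `u + v` have the same
length. -/
lemma exists_triangular_basis {V : ℝ} (hV : 0 < V) :
    ∃ u v, IsLatticeBasis (√V • triangularLattice) V u v ∧ ‖u‖ ^ 2 = V * (2 / √3) ∧
      ‖v‖ ^ 2 = V * (2 / √3) ∧ ‖u + v‖ ^ 2 = V * (2 / √3) := by
  have h3 : √3 ^ 2 = 3 := Real.sq_sqrt (by norm_num)
  have h30 : √3 ≠ 0 := by positivity
  have hS : √V ^ 2 = V := Real.sq_sqrt hV.le
  have hT : √(2 / √3) ^ 2 = 2 / √3 := Real.sq_sqrt (by positivity)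
  unfold triangularLattice
  generalize √V = S at hS
  generalize √(2 / √3) = T at hT
  refine ⟨S • T • vec2 1 0, -(S • T • vec2 (1 / 2) (√3 / 2)), IsLatticeBasis.neg ⟨?_, ?_⟩,
    ?_, ?_, ?_⟩
  · have : det2 (S • T • vec2 1 0) (S • T • vec2 (1 / 2) (√3 / 2)) = V := by
      simp only [det2, PiLp.smul_apply, smul_eq_mul, vec2, WithLp.equiv_symm_apply_ofLp]
      simp
      calc _ = S ^ 2 * T ^ 2 * (√3 / 2) := by ring
        _ = V := by rw [hS, hT]; field_simp
    rw [this, abs_of_pos hV]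
  · ext w
    rw [Set.mem_smul_set]
    constructor
    · rintro ⟨m, n, rfl⟩
      exact ⟨_, ⟨m, n, rfl⟩, by module⟩
    · rintro ⟨_, ⟨m, n, rfl⟩, rfl⟩
      exact ⟨m, n, by module⟩
  all_goals
    simp only [EuclideanSpace.real_norm_sq_eq, Fin.sum_univ_two, PiLp.add_apply, PiLp.neg_apply,
      PiLp.smul_apply, smul_eq_mul, vec2, WithLp.equiv_symm_apply_ofLp]
    simp
    rw [← hT, ← hS]
  · ring
  · linear_combination S ^ 2 * T ^ 2 / 4 * h3
  · linear_combination S ^ 2 * T ^ 2 / 4 * h3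

/-- The bound on the co-volume makes the repulsive part of the energy dominate. -/
lemma mul_thresholdRatio_le {a b V : ℝ} (ha : 0 < a) (hb : 0 < b) (hV : 0 < V) {s : ℕ}
    (hs : 3 < s) (h : V ≤ (a * ((2 * s : ℕ) : ℝ) / (b * 6)) ^ (2 / (((2 * s : ℕ) : ℝ) - 6))) :
    b * (V * (2 / √3))⁻¹ ^ 3 * thresholdRatio s ≤ a * (V * (2 / √3))⁻¹ ^ s := by
  obtain ⟨n, rfl⟩ : ∃ n, s = n + 3 := ⟨s - 3, by omega⟩
  have hn : (0 : ℝ) < n := by exact_mod_cast (by omega : 0 < n)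
  have hpow : V ^ n ≤ a * (n + 3) / (3 * b) := by
    have h1 := pow_le_pow_left₀ hV.le h n
    have h2 : (2 / (((2 * (n + 3) : ℕ) : ℝ) - 6)) * n = 1 := by
      push_cast
      rw [show (2 * ((n : ℝ) + 3) - 6) = 2 * n by ring]
      field_simp
    rw [← Real.rpow_mul_natCast (by positivity), h2, Real.rpow_one] at h1
    refine h1.trans_eq ?_
    push_cast
    field_simp
    norm_num
  rw [thresholdRatio, Nat.add_sub_cancel]
  generalize ht : 2 / √3 = t
  have ht0 : 0 < t := ht ▸ by positivity
  have key : 3 * b / (n + 3) ≤ a * V⁻¹ ^ n := by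
    rw [inv_pow, ← div_eq_mul_inv, le_div_iff₀ (by positivity), div_mul_eq_mul_div,
      div_le_iff₀ (by positivity)]
    rw [le_div_iff₀ (by positivity)] at hpow
    linarith
  calc b * (V * t)⁻¹ ^ 3 * (3 / ((n + 3 : ℕ) : ℝ) * t⁻¹ ^ n)
      = 3 * b / (n + 3) * ((V * t)⁻¹ ^ 3 * t⁻¹ ^ n) := by push_cast; ring
    _ ≤ a * V⁻¹ ^ n * ((V * t)⁻¹ ^ 3 * t⁻¹ ^ n) := by gcongr
    _ = a * (V * t)⁻¹ ^ (n + 3) := by rw [pow_add, mul_inv V t, mul_pow V⁻¹ t⁻¹ n]; ring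

/-- The lattice energy, compared with that of the triangular lattice of the same co-volume. -/
lemma LJenergy_lt_or_isRotationOf {a b V : ℝ} (ha : 0 < a) (hb : 0 < b) (hV : 0 < V) {s : ℕ}
    (hs : s ∈ Finset.Icc 7 12)
    (h : V ≤ (a * ((2 * s : ℕ) : ℝ) / (b * 6)) ^ (2 / (((2 * s : ℕ) : ℝ) - 6)))
    {L : Set (EuclideanSpace ℝ (Fin 2))} (hL : IsLattice2OfCovol L V) :
    LJenergy a b (2 * s : ℕ) 6 (√V • triangularLattice) < LJenergy a b (2 * s : ℕ) 6 L ∨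
      IsRotationOf L (√V • triangularLattice) := by
  have hs7 : 7 ≤ s := (Finset.mem_Icc.1 hs).1
  obtain ⟨u₀, v₀, -, hdet, hL⟩ := hL
  obtain ⟨u, v, hbas, h1, h2, h3⟩ := IsLatticeBasis.exists_reduced ⟨hdet, hL.symm⟩ hV
  obtain ⟨p, q, htri, hp, hq, hpq⟩ := exists_triangular_basis hV
  have hred := hbas.isReduced hV h1 h2 h3
  have hratio := mul_thresholdRatio_le ha hb hV (by omega) h
  have hΛ : 0 < V * (2 / √3) := by positivity
  generalize V * (2 / √3) = Λ at hred hratio hp hq hpq hΛ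
  generalize hc : (‖u‖ ^ 2 + ‖v‖ ^ 2 + ‖u + v‖ ^ 2) / Λ / 3 = c at hred
  have hdet_uv : det2 u v ≠ 0 := abs_pos.1 (hbas.1 ▸ hV)
  have hdet_pq : det2 p q ≠ 0 := abs_pos.1 (htri.1 ▸ hV)
  have hcancel : ∀ t : ℝ, t = Λ * (t / Λ) := fun t => by field_simp
  rcases hred.toIsOrbitTriple.one_le.lt_or_eq with hc1 | hc1
  · left
    rw [← hbas.2, ← htri.2]
    have e1 := LJenergy_latticeSet hdet_uv hred.toIsOrbitTriple (hcancel _) (hcancel _)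
      (hcancel _) a b (s := s) (by omega)
    have e2 := LJenergy_latticeSet hdet_pq isOrbitTriple_one (Λ := Λ) (by rw [hp, mul_one])
      (by rw [hq, mul_one]) (by rw [hpq, mul_one]) a b (s := s) (by omega)
    have hX := hred.formZeta_hex_le hs7
    have hY := hred.formZeta_gap_threshold hc1 hs
    have hbΛ : 0 < b * Λ⁻¹ ^ 3 := by positivity
    push_cast
    rw [e1, e2]
    nlinarith [mul_nonneg (sub_nonneg.2 hratio) (sub_nonneg.2 hX),
      mul_pos hbΛ (sub_pos.2 hY)]
  · right
    rw [← hc1] at hred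
    obtain ⟨hu, hv, huv⟩ := hred.toIsOrbitTriple.eq_one
    rw [div_eq_one_iff_eq hΛ.ne'] at hu hv huv
    obtain ⟨O, hOp, hOq⟩ := exists_isometry hdet_pq (hp.trans hu.symm) (hq.trans hv.symm)
      (hpq.trans huv.symm)
    exact ⟨O, by rw [← htri.2, image_latticeSet, hOp, hOq, hbas.2]⟩

/-- Optimality at fixed high density for Lennard-Jones type energies with exponents
`α ∈ {14,16,18,20,22,24}`, `β = 6`: for `a, b > 0` and `0 < V ≤ (aα/(bβ))^{2/(α-β)}`,
the triangular lattice `√V·A₂` is the unique minimizer, up to rotation,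
of `E_f` among lattices of co-volume `V`. -/
theorem LJ_other_exponents_fixed_density_minimality
    (α β : ℝ) (hα : α ∈ ({14, 16, 18, 20, 22, 24} : Set ℝ)) (hβ : β = 6)
    (a b : ℝ) (ha : 0 < a) (hb : 0 < b) (V : ℝ) (hV0 : 0 < V)
    (hV : V ≤ (a * α / (b * β)) ^ (2 / (α - β))) :
    ∀ L : Set (EuclideanSpace ℝ (Fin 2)), IsLattice2OfCovol L V →
      LJenergy a b α β (Real.sqrt V • triangularLattice) ≤ LJenergy a b α β L ∧
      (LJenergy a b α β L = LJenergy a b α β (Real.sqrt V • triangularLattice) ↔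
        IsRotationOf L (Real.sqrt V • triangularLattice)) := by
  subst hβ
  obtain ⟨s, hs, rfl⟩ : ∃ s ∈ Finset.Icc 7 12, α = ((2 * s : ℕ) : ℝ) := by
    simp only [Set.mem_insert_iff, Set.mem_singleton_iff] at hα
    rcases hα with rfl | rfl | rfl | rfl | rfl | rfl
    exacts [⟨7, by simp, by norm_num⟩, ⟨8, by simp, by norm_num⟩, ⟨9, by simp, by norm_num⟩,
      ⟨10, by simp, by norm_num⟩, ⟨11, by simp, by norm_num⟩, ⟨12, by simp, by norm_num⟩]
  intro L hL
  have hrot : IsRotationOf L (√V • triangularLattice) →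
      LJenergy a b (2 * s : ℕ) 6 L = LJenergy a b (2 * s : ℕ) 6 (√V • triangularLattice) := by
    rintro ⟨O, rfl⟩
    exact LJenergy_image a b _ _ O _
  rcases LJenergy_lt_or_isRotationOf ha hb hV0 hs hV hL with h | h
  · exact ⟨h.le, fun heq => absurd heq h.ne', hrot⟩
  · exact ⟨(hrot h).ge, fun _ => h, hrot⟩
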